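/- arXiv:2010.10066 — 9 statements merged into one kernel-verified Lean document; each statement's English description precedes it below -/
import Mathlib

section
/- If (G,σ) is a signed graph and (F,π) is a signed forest with at least one edge (i.e., the underlying graph F is acyclic and has at least one edge), then χ_s((G,σ) □ (F,π)) = χ_s((G,σ) □ K₂⁺), where K₂⁺ is the signed graph consisting of a single positive edge. -/
open SimpleGraph

/-- Two signatures on a graph `G` are equivalent (`σ₂` is obtained from `σ₁` by
switching the set of vertices `{v | s v = true}`); signs are encoded by `Bool`,
with `true` meaning negative, so that the product of signs is `xor`. -/
def SigEquiv {V : Type*} (G : SimpleGraph V) (σ₁ σ₂ : V → V → Bool) : Prop :=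
  ∃ s : V → Bool, ∀ u v, G.Adj u v → σ₂ u v = xor (σ₁ u v) (xor (s u) (s v))

/-- A homomorphism of signed graphs `(G, σ) → (H, π)`: a graph homomorphism
mapping some switching-equivalent signature of `σ` to `π`. -/
def SHom {V W : Type*} (G : SimpleGraph V) (σ : V → V → Bool)
    (H : SimpleGraph W) (π : W → W → Bool) : Prop :=
  ∃ (φ : G →g H) (σ' : V → V → Bool),
    SigEquiv G σ σ' ∧ ∀ u v, G.Adj u v → π (φ u) (φ v) = σ' u v

/-- The chromatic number of a signed graph: the least number of vertices of a
signed graph to which it admits a homomorphism of signed graphs. -/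
noncomputable def sChrom {V : Type*} (G : SimpleGraph V) (σ : V → V → Bool) : ℕ :=
  sInf {n : ℕ | ∃ (H : SimpleGraph (Fin n)) (π : Fin n → Fin n → Bool), SHom G σ H π}

/-- The signature of the Cartesian (box) product of two signed graphs:
a copy of an edge of `H` inside a `G`-fiber keeps its sign, and vice versa. -/
def prodSign {V W : Type*} [DecidableEq V] (σ : V → V → Bool) (π : W → W → Bool)
    (p q : V × W) : Bool :=
  if p.1 = q.1 then π p.2 q.2 else σ p.1 q.1

/-- Composition of homomorphisms of signed graphs. -/
theorem SHom.trans {U V W : Type*} {G : SimpleGraph U} {σ : U → U → Bool}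
    {H : SimpleGraph V} {π : V → V → Bool} {K : SimpleGraph W} {ρ : W → W → Bool}
    (h₁ : SHom G σ H π) (h₂ : SHom H π K ρ) : SHom G σ K ρ := by
  obtain ⟨φ, σ', ⟨s, hs⟩, h⟩ := h₁
  obtain ⟨ψ, π', ⟨t, ht⟩, k⟩ := h₂
  refine ⟨ψ.comp φ, fun u v => ρ (ψ (φ u)) (ψ (φ v)), ⟨fun u => xor (s u) (t (φ u)), ?_⟩,
    fun u v _ => rfl⟩
  intro u v huv
  have hφ := φ.map_adj huv
  change ρ (ψ (φ u)) (ψ (φ v)) = _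
  rw [k _ _ hφ, ht _ _ hφ, h _ _ huv, hs _ _ huv]
  simp only [Bool.xor_assoc, Bool.xor_left_comm]

/-- Signed graphs that map to each other have the same chromatic number. -/
theorem sChrom_congr {V W : Type*} {G : SimpleGraph V} {σ : V → V → Bool}
    {H : SimpleGraph W} {π : W → W → Bool} (h₁ : SHom G σ H π) (h₂ : SHom H π G σ) :
    sChrom G σ = sChrom H π := by
  unfold sChrom
  congr 1
  ext n
  exact ⟨fun ⟨K, ρ, h⟩ => ⟨K, ρ, h₂.trans h⟩, fun ⟨K, ρ, h⟩ => ⟨K, ρ, h₁.trans h⟩⟩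

/-- Every symmetric signature of a finite forest is a switching of the positive one. -/
theorem SimpleGraph.IsAcyclic.exists_switching {V : Type*} [Finite V] {F : SimpleGraph V}
    (hF : F.IsAcyclic) (π : V → V → Bool) (hπ : ∀ u v, π u v = π v u) :
    ∃ s : V → Bool, ∀ u v, F.Adj u v → π u v = xor (s u) (s v) := by
  classical
  induction F using WellFoundedLT.induction with
  | ind F ih =>
  by_cases hE : ∃ u v, F.Adj u v
  · obtain ⟨u, v, huv⟩ := hE
    have hle : F.deleteEdges {s(u, v)} ≤ F := F.deleteEdges_le _
    have hnadj : ¬ (F.deleteEdges {s(u, v)}).Adj u v := by simp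
    have hlt : F.deleteEdges {s(u, v)} < F :=
      lt_of_le_of_ne hle fun h => hnadj (h.ge huv)
    obtain ⟨s, hs⟩ := ih _ hlt (hF.anti hle)
    have hnr : ¬ (F.deleteEdges {s(u, v)}).Reachable u v :=
      isBridge_iff.1 (isAcyclic_iff_forall_adj_isBridge.1 hF huv)
    refine ⟨fun w => xor (s w) (decide ((F.deleteEdges {s(u, v)}).Reachable u w) &&
      xor (π u v) (xor (s u) (s v))), fun w x hwx => ?_⟩
    by_cases he : s(w, x) = s(u, v)
    · have hr : (F.deleteEdges {s(u, v)}).Reachable u u := Reachable.refl u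
      rcases Sym2.eq_iff.1 he with ⟨rfl, rfl⟩ | ⟨rfl, rfl⟩
      · simp only [hr, hnr]
        cases π w x <;> cases s w <;> cases s x <;> simp
      · simp only [hr, hnr, hπ w x]
        cases π x w <;> cases s w <;> cases s x <;> simp
    · have hadj : (F.deleteEdges {s(u, v)}).Adj w x := by
        rw [deleteEdges_adj]
        exact ⟨hwx, by simpa using he⟩
      have hr : (F.deleteEdges {s(u, v)}).Reachable u w ↔
          (F.deleteEdges {s(u, v)}).Reachable u x :=
        ⟨fun h => h.trans hadj.reachable, fun h => h.trans hadj.symm.reachable⟩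
      simp only [hr, hs w x hadj]
      rw [Bool.xor_comm (s x), ← Bool.xor_assoc, Bool.xor_assoc (s w), Bool.xor_self,
        Bool.xor_false]
  · exact ⟨fun _ => false, fun u v h => (hE ⟨u, v, h⟩).elim⟩

/-- A homomorphism of signed graphs induces one between box products with a fixed factor. -/
theorem SHom.boxProd_left {U V W : Type*} [DecidableEq U] (G : SimpleGraph U)
    (σ : U → U → Bool) {H : SimpleGraph V} {π : V → V → Bool} {K : SimpleGraph W}
    {ρ : W → W → Bool} (h : SHom H π K ρ) :
    SHom (G □ H) (prodSign σ π) (G □ K) (prodSign σ ρ) := by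
  obtain ⟨φ, π', ⟨s, hs⟩, h⟩ := h
  refine ⟨⟨fun p => (p.1, φ p.2), ?_⟩, fun p q => prodSign σ ρ (p.1, φ p.2) (q.1, φ q.2),
    ⟨fun p => s p.2, ?_⟩, fun _ _ _ => rfl⟩
  · rintro ⟨a, b⟩ ⟨c, d⟩ hadj
    rw [boxProd_adj] at hadj ⊢
    rcases hadj with ⟨h₁, h₂⟩ | ⟨h₁, h₂⟩
    · exact Or.inl ⟨h₁, congrArg φ h₂⟩
    · exact Or.inr ⟨φ.map_adj h₁, h₂⟩
  · rintro ⟨a, b⟩ ⟨c, d⟩ hadj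
    rw [boxProd_adj] at hadj
    rcases hadj with ⟨h₁, h₂⟩ | ⟨h₁, h₂⟩
    · have hne : a ≠ c := h₁.ne
      dsimp only at h₂
      simp [prodSign, hne, h₂]
    · dsimp only at h₁ h₂
      simp [prodSign, h₂, h b d h₁, hs b d h₁]

/-- A finite signed forest maps to the signed graph consisting of one positive edge. -/
theorem SimpleGraph.IsAcyclic.sHom_top {V : Type*} [Finite V] {F : SimpleGraph V}
    (hF : F.IsAcyclic) (π : V → V → Bool) (hπ : ∀ u v, π u v = π v u) :
    SHom F π (⊤ : SimpleGraph (Fin 2)) (fun _ _ => false) := by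
  obtain ⟨c, hc⟩ := hF.exists_switching (fun _ _ => true) fun _ _ => rfl
  obtain ⟨s, hs⟩ := hF.exists_switching π hπ
  refine ⟨⟨fun v => if c v then 1 else 0, ?_⟩, fun _ _ => false, ⟨s, ?_⟩, fun _ _ _ => rfl⟩
  · intro u v huv
    have := hc u v huv
    rw [top_adj]
    grind
  · intro u v huv
    rw [hs u v huv, Bool.xor_self]

/-- The signed graph consisting of one positive edge maps to every signed graph with an edge. -/
theorem SimpleGraph.Adj.sHom_of_top {V : Type*} {F : SimpleGraph V} {u v : V}
    (huv : F.Adj u v) (π : V → V → Bool) (hπ : ∀ u v, π u v = π v u) :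
    SHom (⊤ : SimpleGraph (Fin 2)) (fun _ _ => false) F π := by
  refine ⟨⟨![u, v], ?_⟩, fun i j => π (![u, v] i) (![u, v] j),
    ⟨![false, π u v], ?_⟩, fun _ _ _ => rfl⟩
  · intro i j hij
    fin_cases i <;> fin_cases j <;> simp_all [huv.symm]
  · intro i j hij
    fin_cases i <;> fin_cases j <;> simp_all [hπ v u]

/-- For a signed graph `(G, σ)` and a signed forest `(F, π)` with at least one
edge, the chromatic number of `(G,σ) □ (F,π)` equals that of `(G,σ) □ K₂⁺`. -/
theorem chrom_boxProd_forest
    {α β : Type} [Fintype α] [Fintype β] [DecidableEq α]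
    (G : SimpleGraph α) (σ : α → α → Bool) (hσ : ∀ u v, σ u v = σ v u)
    (F : SimpleGraph β) (π : β → β → Bool) (hπ : ∀ u v, π u v = π v u)
    (hF : F.IsAcyclic) (hedge : ∃ u v, F.Adj u v) :
    sChrom (G □ F) (prodSign σ π) =
      sChrom (G □ (⊤ : SimpleGraph (Fin 2))) (prodSign σ (fun _ _ => false)) := by
  obtain ⟨u, v, huv⟩ := hedge
  exact sChrom_congr ((hF.sHom_top π hπ).boxProd_left G σ)
    ((huv.sHom_of_top π hπ).boxProd_left G σ)
end

section
/- For all integers n, m ≥ 2 and all signatures σ₁ on the path P_n and σ₂ on the path P_m, the Cartesian product of signed graphs (P_n,σ₁) □ (P_m,σ₂) has signed chromatic number χ_s((P_n,σ₁) □ (P_m,σ₂)) = 2, where P_k denotes the path on k vertices. -/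
open SimpleGraph

/-- Every signature of a path is obtained from the all-positive one by switching. -/
theorem exists_switching_pathGraph {n : ℕ} (σ : Fin n → Fin n → Bool)
    (hσ : ∀ u v, σ u v = σ v u) :
    ∃ s : Fin n → Bool, ∀ u v, (pathGraph n).Adj u v → σ u v = xor (s u) (s v) := by
  let t : ℕ → Bool := fun k => Nat.rec false
    (fun k b => xor b (if h : k + 1 < n then σ ⟨k, by omega⟩ ⟨k + 1, h⟩ else false)) k
  have ht (u v : Fin n) (h : u.val + 1 = v.val) : σ u v = xor (t u) (t v) := by
    obtain ⟨u, hu⟩ := u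
    obtain ⟨v, hv⟩ := v
    obtain rfl : u + 1 = v := h
    have : t (u + 1) = xor (t u) (σ ⟨u, hu⟩ ⟨u + 1, hv⟩) := by
      simp only [t, dif_pos hv]
    simp [this]
  refine ⟨fun u => t u, fun u v h => ?_⟩
  rcases pathGraph_adj.mp h with h | h
  · exact ht u v h
  · rw [hσ, ht v u h, Bool.xor_comm]

/-- If two signatures are obtained from the all-positive ones by switching, then so is
the signature of the product. -/
theorem sigEquiv_prodSign_false {V W : Type*} [DecidableEq V] {G : SimpleGraph V}
    {H : SimpleGraph W} {σ : V → V → Bool} {π : W → W → Bool} {s : V → Bool} {t : W → Bool}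
    (hs : ∀ u v, G.Adj u v → σ u v = xor (s u) (s v))
    (ht : ∀ u v, H.Adj u v → π u v = xor (t u) (t v)) :
    SigEquiv (G □ H) (prodSign σ π) fun _ _ => false := by
  refine ⟨fun p => xor (s p.1) (t p.2), ?_⟩
  rintro ⟨a, b⟩ ⟨c, d⟩ h
  rcases boxProd_adj.mp h with ⟨h, rfl⟩ | ⟨h, rfl⟩
  · have hne := h.ne
    simp only [prodSign, if_neg hne, hs _ _ h]
    cases s a <;> cases s c <;> cases t b <;> rfl
  · simp only [prodSign, if_true, ht _ _ h]
    cases s a <;> cases t b <;> cases t d <;> rfl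

/-- A signed graph with an edge has chromatic number `2` if it is bipartite and its signature is
equivalent to the all-positive one. -/
theorem sChrom_eq_two {V : Type*} {G : SimpleGraph V} {σ : V → V → Bool}
    (hσ : SigEquiv G σ fun _ _ => false) (hG : G.Colorable 2) {u v : V} (huv : G.Adj u v) :
    sChrom G σ = 2 := by
  obtain ⟨c⟩ := hG
  have hmem : 2 ∈ {n : ℕ | ∃ (H : SimpleGraph (Fin n)) (π : Fin n → Fin n → Bool),
      SHom G σ H π} := ⟨⊤, fun _ _ => false, c, _, hσ, fun _ _ _ => rfl⟩
  refine le_antisymm (Nat.sInf_le hmem) (le_csInf ⟨2, hmem⟩ ?_)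
  rintro k ⟨H, π, φ, -⟩
  have hne := (φ.map_adj huv).ne
  have := Fin.val_ne_of_ne hne
  omega

/-- The grid graph is bipartite. -/
theorem colorable_two_boxProd_pathGraph (n m : ℕ) :
    (pathGraph n □ pathGraph m).Colorable 2 := by
  refine ⟨Coloring.mk (fun p => ⟨(p.1.val + p.2.val) % 2, Nat.mod_lt _ two_pos⟩) ?_⟩
  rintro ⟨a, b⟩ ⟨c, d⟩ h
  simp only [boxProd_adj, pathGraph_adj, ne_eq, Fin.mk.injEq] at h ⊢
  rcases h with ⟨h, rfl⟩ | ⟨h, rfl⟩ <;> omega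

/-- The Cartesian product of two signed paths on at least two vertices has
chromatic number `2`. -/
theorem chrom_boxProd_paths (n m : ℕ) (hn : 2 ≤ n) (hm : 2 ≤ m)
    (σ₁ : Fin n → Fin n → Bool) (hσ₁ : ∀ u v, σ₁ u v = σ₁ v u)
    (σ₂ : Fin m → Fin m → Bool) (hσ₂ : ∀ u v, σ₂ u v = σ₂ v u) :
    sChrom (pathGraph n □ pathGraph m) (prodSign σ₁ σ₂) = 2 := by
  obtain ⟨s, hs⟩ := exists_switching_pathGraph σ₁ hσ₁
  obtain ⟨t, ht⟩ := exists_switching_pathGraph σ₂ hσ₂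
  refine sChrom_eq_two (sigEquiv_prodSign_false hs ht) (colorable_two_boxProd_pathGraph n m)
    (u := (⟨0, by omega⟩, ⟨0, by omega⟩)) (v := (⟨1, by omega⟩, ⟨0, by omega⟩)) ?_
  exact boxProd_adj.mpr (Or.inl ⟨pathGraph_adj.mpr (Or.inl rfl), rfl⟩)
end

section
/- For all integers n, m ≥ 1 and every signature σ on the grid graph P_n □ P_m (the Cartesian product of the paths on n and m vertices), the signed grid (P_n □ P_m, σ) satisfies χ_s(P_n □ P_m, σ) ≤ 6. -/
open SimpleGraph

/-- The signature of the complete graph on six vertices obtained from the Paley graph on five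
vertices by adding a vertex all of whose edges are positive. -/
def paleySign (i j : Fin 6) : Bool :=
  decide (i ≠ 5 ∧ j ≠ 5 ∧ ((i.val + 5 - j.val) % 5 = 2 ∨ (i.val + 5 - j.val) % 5 = 3))

/-- Adjacency with sign `s` in the switching double cover of the complete graph signed by
`paleySign`: a vertex of the cover is a vertex of the base with a switching bit. -/
def CoverAdj (s : Bool) (x y : Fin 6 × Bool) : Prop :=
  x.1 ≠ y.1 ∧ paleySign x.1 y.1 = xor s (xor x.2 y.2)

lemma paleySign_comm (i j : Fin 6) : paleySign i j = paleySign j i := by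
  revert i j; decide

lemma CoverAdj.symm {s : Bool} {x y : Fin 6 × Bool} (h : CoverAdj s x y) : CoverAdj s y x :=
  ⟨h.1.symm, by rw [paleySign_comm, h.2, Bool.xor_comm x.2]⟩

lemma exists_coverAdj_ne (s : Bool) (x : Fin 6 × Bool) (k : Fin 6) :
    ∃ y, CoverAdj s x y ∧ y.1 ≠ k := by
  obtain ⟨i, hi, hk⟩ : ∃ i : Fin 6, x.1 ≠ i ∧ i ≠ k := by
    generalize x.1 = j
    revert j k
    decide
  refine ⟨(i, xor (paleySign x.1 i) (xor s x.2)), ⟨hi, ?_⟩, hk⟩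
  cases paleySign x.1 i <;> cases s <;> cases x.2 <;> rfl

lemma exists_paleySign_xor (a b k : Fin 6) (hab : a ≠ b) (t : Bool) :
    ∃ i, a ≠ i ∧ b ≠ i ∧ i ≠ k ∧ xor (paleySign a i) (paleySign b i) = t := by
  revert a b k t
  decide

lemma exists_common_coverAdj_ne (s t : Bool) (x y : Fin 6 × Bool) (hxy : x.1 ≠ y.1) (k : Fin 6) :
    ∃ z, CoverAdj s x z ∧ CoverAdj t y z ∧ z.1 ≠ k := by
  obtain ⟨i, hx, hy, hk, h⟩ :=
    exists_paleySign_xor x.1 y.1 k hxy (xor (xor s x.2) (xor t y.2))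
  refine ⟨(i, xor (paleySign x.1 i) (xor s x.2)), ⟨hx, ?_⟩, ⟨hy, ?_⟩, hk⟩
  · cases paleySign x.1 i <;> cases s <;> cases x.2 <;> rfl
  · revert h
    cases paleySign x.1 i <;> cases paleySign y.1 i <;> cases s <;> cases t <;>
      cases x.2 <;> cases y.2 <;> simp

lemma exists_seq_of_step {α : Type*} (I : ℕ → α → Prop) (Q : ℕ → α → α → Prop)
    (h0 : ∃ x, I 0 x) (hs : ∀ j x, I j x → ∃ y, I (j + 1) y ∧ Q j x y) :
    ∃ g : ℕ → α, ∀ j, I j (g j) ∧ Q j (g j) (g (j + 1)) := by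
  choose! next hI hQ using hs
  obtain ⟨x, hx⟩ := h0
  let g : ℕ → α := fun j => Nat.rec x next j
  have hg : ∀ j, I j (g j) := fun j => by
    induction j with
    | zero => exact hx
    | succ j ih => exact hI j _ ih
  exact ⟨g, fun j => ⟨hg j, hQ j _ (hg j)⟩⟩

/-- Every colouring of a row extends to the next row. -/
lemma exists_next_row (f : ℕ → Fin 6 × Bool) (h v : ℕ → Bool) :
    ∃ g : ℕ → Fin 6 × Bool,
      (∀ j, CoverAdj (h j) (g j) (g (j + 1))) ∧ ∀ j, CoverAdj (v j) (f j) (g j) := by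
  obtain ⟨g, hg⟩ := exists_seq_of_step
    (fun j x => CoverAdj (v j) (f j) x ∧ x.1 ≠ (f (j + 1)).1)
    (fun j x y => CoverAdj (h j) x y)
    (exists_coverAdj_ne _ _ _)
    (fun j x hx => by
      obtain ⟨z, hz, hz', hk⟩ := exists_common_coverAdj_ne (h j) (v (j + 1)) x (f (j + 1)) hx.2
        (f (j + 2)).1
      exact ⟨z, ⟨hz', hk⟩, hz⟩)
  exact ⟨g, fun j => (hg j).2, fun j => (hg j).1.1⟩

lemma exists_grid_colouring (h v : ℕ → ℕ → Bool) :
    ∃ F : ℕ → ℕ → Fin 6 × Bool,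
      (∀ i j, CoverAdj (h i j) (F i j) (F i (j + 1))) ∧
        ∀ i j, CoverAdj (v i j) (F i j) (F (i + 1) j) := by
  obtain ⟨F, hF⟩ := exists_seq_of_step
    (fun i f => ∀ j, CoverAdj (h i j) (f j) (f (j + 1)))
    (fun i f g => ∀ j, CoverAdj (v i j) (f j) (g j))
    ((exists_next_row (fun _ => (0, false)) (h 0) (fun _ => false)).imp fun _ hg => hg.1)
    (fun i f _ => exists_next_row f (h (i + 1)) (v i))
  exact ⟨F, fun i => (hF i).1, fun i => (hF i).2⟩

/-- Every signed grid has chromatic number at most `6`. -/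
theorem chrom_signed_grid_le_six (n m : ℕ) (hn : 1 ≤ n) (hm : 1 ≤ m)
    (σ : Fin n × Fin m → Fin n × Fin m → Bool) (hσ : ∀ p q, σ p q = σ q p) :
    sChrom (pathGraph n □ pathGraph m) σ ≤ 6 := by
  obtain ⟨F, hrow, hcol⟩ := exists_grid_colouring
    (fun i j => if hij : i < n ∧ j + 1 < m then
      σ (⟨i, hij.1⟩, ⟨j, by omega⟩) (⟨i, hij.1⟩, ⟨j + 1, hij.2⟩) else false)
    (fun i j => if hij : i + 1 < n ∧ j < m then
      σ (⟨i, by omega⟩, ⟨j, hij.2⟩) (⟨i + 1, hij.1⟩, ⟨j, hij.2⟩) else false)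
  have hrow' : ∀ (i : Fin n) (j k : Fin m), j.val + 1 = k.val →
      CoverAdj (σ (i, j) (i, k)) (F i j) (F i k) := by
    rintro ⟨i, hi⟩ ⟨j, hj⟩ ⟨k, hk⟩ rfl
    simpa [hi, hk] using hrow i j
  have hcol' : ∀ (i k : Fin n) (j : Fin m), i.val + 1 = k.val →
      CoverAdj (σ (i, j) (k, j)) (F i j) (F k j) := by
    rintro ⟨i, hi⟩ ⟨k, hk⟩ ⟨j, hj⟩ rfl
    simpa [hj, hk] using hcol i j
  have hF : ∀ p q, (pathGraph n □ pathGraph m).Adj p q →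
      CoverAdj (σ p q) (F p.1 p.2) (F q.1 q.2) := by
    rintro ⟨i, j⟩ ⟨k, l⟩ hpq
    simp only [boxProd_adj, pathGraph_adj] at hpq
    rcases hpq with ⟨h | h, rfl⟩ | ⟨h | h, rfl⟩
    · exact hcol' _ _ _ h
    · rw [hσ]; exact (hcol' _ _ _ h).symm
    · exact hrow' _ _ _ h
    · rw [hσ]; exact (hrow' _ _ _ h).symm
  exact Nat.sInf_le ⟨⊤, paleySign, ⟨fun p => (F p.1 p.2).1, fun h => (hF _ _ h).1⟩,
    fun p q => paleySign (F p.1 p.2).1 (F q.1 q.2).1,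
    ⟨fun p => (F p.1 p.2).2, fun p q h => (hF p q h).2⟩, fun _ _ _ => rfl⟩
end

section
/- There exists a signature σ on the grid graph P_4 □ P_3 (the Cartesian product of the path on 4 vertices and the path on 3 vertices) such that χ_s(P_4 □ P_3, σ) = 5. -/
open SimpleGraph

/-- A signed graph with a homomorphism to a signed graph on at most four vertices has a proper
colouring by `Fin 4` whose switched edge signs are read off from a symmetric sign function. -/
theorem SHom.exists_coloring_fin_four {V : Type*} {G : SimpleGraph V} {σ : V → V → Bool} {n : ℕ}
    {H : SimpleGraph (Fin n)} {π : Fin n → Fin n → Bool} (h : SHom G σ H π)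
    (hσ : ∀ u v, σ u v = σ v u) (hn : n ≤ 4) :
    ∃ (c : V → Fin 4) (s : V → Bool) (q : Fin 4 → Fin 4 → Bool), (∀ a b, q a b = q b a) ∧
      ∀ u v, G.Adj u v → c u ≠ c v ∧ q (c u) (c v) = xor (σ u v) (xor (s u) (s v)) := by
  classical
  obtain ⟨φ, σ', ⟨s, hs⟩, hπ⟩ := h
  have hsign (u v) (huv : G.Adj u v) :
      xor (σ u v) (xor (s u) (s v)) = π (φ u) (φ v) := by
    rw [hπ u v huv, hs u v huv]
  let c : V → Fin 4 := fun v => Fin.castLE hn (φ v)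
  refine ⟨c, s, fun a b => decide (∃ u v, G.Adj u v ∧ c u = a ∧ c v = b ∧
    xor (σ u v) (xor (s u) (s v)) = true), fun a b => ?_, fun u v huv => ⟨fun hc => ?_, ?_⟩⟩
  · rw [decide_eq_decide]
    constructor <;> rintro ⟨u, v, huv, hu, hv, hsgn⟩ <;>
      exact ⟨v, u, huv.symm, hv, hu, by rw [hσ, Bool.xor_comm (s v)]; exact hsgn⟩
  · exact (φ.map_rel huv).ne (Fin.castLE_injective hn hc)
  · rw [Bool.eq_iff_iff, decide_eq_true_iff]
    constructor
    · rintro ⟨u', v', huv', hu, hv, hsgn⟩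
      rw [hsign _ _ huv, ← Fin.castLE_injective hn hu, ← Fin.castLE_injective hn hv,
        ← hsign _ _ huv']
      exact hsgn
    · exact fun hsgn => ⟨u, v, huv, rfl, rfl, hsgn⟩

/-- The sign of the closed walk `a, b, c, d, a`. -/
def quadSign {W : Type*} (q : W → W → Bool) (a b c d : W) : Bool :=
  xor (xor (q a b) (q b c)) (xor (q c d) (q d a))

theorem quadSign_reverse {W : Type*} {q : W → W → Bool} (hq : ∀ a b, q a b = q b a)
    (a b c d : W) : quadSign q a b c d = quadSign q d c b a := by
  simp only [quadSign, hq d c, hq c b, hq b a, hq a d]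
  cases q a b <;> cases q b c <;> cases q c d <;> cases q d a <;> rfl

/-- Switching does not change the sign of a closed walk of length four. -/
theorem quadSign_eq_of_switch {V W : Type*} {G : SimpleGraph V} {σ : V → V → Bool}
    {f : V → W} {s : V → Bool} {q : W → W → Bool}
    (h : ∀ u v, G.Adj u v → q (f u) (f v) = xor (σ u v) (xor (s u) (s v))) {u v w x : V}
    (huv : G.Adj u v) (hvw : G.Adj v w) (hwx : G.Adj w x) (hxu : G.Adj x u) :
    quadSign q (f u) (f v) (f w) (f x) = quadSign σ u v w x := by
  simp only [quadSign, h _ _ huv, h _ _ hvw, h _ _ hwx, h _ _ hxu]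
  cases s u <;> cases s v <;> cases s w <;> cases s x <;> simp

/-- The sign function on `K₄` with prescribed signs on its six edges. -/
def k4Sign (x₀₁ x₀₂ x₀₃ x₁₂ x₁₃ x₂₃ : Bool) : Fin 4 → Fin 4 → Bool :=
  ![![false, x₀₁, x₀₂, x₀₃], ![x₀₁, false, x₁₂, x₁₃],
    ![x₀₂, x₁₂, false, x₂₃], ![x₀₃, x₁₃, x₂₃, false]]

theorem eq_k4Sign {q : Fin 4 → Fin 4 → Bool} (hq : ∀ a b, q a b = q b a) {a b : Fin 4}
    (hab : a ≠ b) :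
    q a b = k4Sign (q 0 1) (q 0 2) (q 0 3) (q 1 2) (q 1 3) (q 2 3) a b := by
  fin_cases a <;> fin_cases b <;> first | exact absurd rfl hab | rfl | exact hq _ _

theorem quadSign_eq_quadSign_k4Sign {q : Fin 4 → Fin 4 → Bool} (hq : ∀ a b, q a b = q b a)
    {a b c d : Fin 4} (hab : a ≠ b) (hbc : b ≠ c) (hcd : c ≠ d) (hda : d ≠ a) :
    quadSign q a b c d =
      quadSign (k4Sign (q 0 1) (q 0 2) (q 0 3) (q 1 2) (q 1 3) (q 2 3)) a b c d := by
  simp only [quadSign, ← eq_k4Sign hq hab, ← eq_k4Sign hq hbc, ← eq_k4Sign hq hcd,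
    ← eq_k4Sign hq hda]

/-- If no closed walk of length four having `d` and `f` opposite is negative, we call `d` and `f`
evenly joined; this includes the case `d = f`. -/
def EvenlyJoined (q : Fin 4 → Fin 4 → Bool) (d f : Fin 4) : Prop :=
  ∀ y z, y ≠ d → y ≠ f → z ≠ d → z ≠ f → quadSign q d y f z = false

instance (q : Fin 4 → Fin 4 → Bool) (d f : Fin 4) : Decidable (EvenlyJoined q d f) :=
  inferInstanceAs (Decidable (∀ _ _, _))

theorem evenlyJoined_k4Sign : ∀ x₀₁ x₀₂ x₀₃ x₁₂ x₁₃ x₂₃ : Bool,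
    ∀ b e, b ≠ e → ∀ a, a ≠ b → ∀ d, d ≠ e → a ≠ d →
      quadSign (k4Sign x₀₁ x₀₂ x₀₃ x₁₂ x₁₃ x₂₃) a b e d = true →
    ∀ c, b ≠ c → ∀ f, e ≠ f → c ≠ f →
      quadSign (k4Sign x₀₁ x₀₂ x₀₃ x₁₂ x₁₃ x₂₃) b c f e = true →
    EvenlyJoined (k4Sign x₀₁ x₀₂ x₀₃ x₁₂ x₁₃ x₂₃) d f := by
  decide +kernel

theorem quadSign_k4Sign_of_evenlyJoined : ∀ x₀₁ x₀₂ x₀₃ x₁₂ x₁₃ x₂₃ : Bool,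
    ∀ a c, EvenlyJoined (k4Sign x₀₁ x₀₂ x₀₃ x₁₂ x₁₃ x₂₃) a c →
    ∀ d f, EvenlyJoined (k4Sign x₀₁ x₀₂ x₀₃ x₁₂ x₁₃ x₂₃) d f →
    a ≠ d → c ≠ f → ∀ b, a ≠ b → b ≠ c → ∀ e, b ≠ e → d ≠ e → e ≠ f →
      quadSign (k4Sign x₀₁ x₀₂ x₀₃ x₁₂ x₁₃ x₂₃) a b e d = false →
      quadSign (k4Sign x₀₁ x₀₂ x₀₃ x₁₂ x₁₃ x₂₃) b c f e = false := by
  decide +kernel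

/-- The signature of the grid `P₄ □ P₃` with four negative edges, for which exactly one of the six
square faces is positive, namely a face of the middle strip. -/
def gridSignature (p q : Fin 4 × Fin 3) : Bool :=
  decide (s(p, q) ∈ ({s((1, 0), (1, 1)), s((2, 0), (2, 1)), s((1, 1), (1, 2)),
    s((3, 1), (3, 2))} : Finset (Sym2 (Fin 4 × Fin 3))))

theorem gridSignature_comm (p q : Fin 4 × Fin 3) : gridSignature p q = gridSignature q p := by
  simp only [gridSignature, Sym2.eq_swap]

theorem four_lt_of_sHom_gridSignature {n : ℕ} {H : SimpleGraph (Fin n)}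
    {π : Fin n → Fin n → Bool}
    (h : SHom (pathGraph 4 □ pathGraph 3) gridSignature H π) : 4 < n := by
  by_contra! hn
  obtain ⟨c, s, q, hq, hc⟩ := h.exists_coloring_fin_four gridSignature_comm hn
  have hrow (i : Fin 4) (j : Fin 2) :
      (pathGraph 4 □ pathGraph 3).Adj (i, j.castSucc) (i, j.succ) := by
    simp [boxProd_adj, pathGraph_adj]
  have hcol (i : Fin 3) (j : Fin 3) :
      (pathGraph 4 □ pathGraph 3).Adj (i.castSucc, j) (i.succ, j) := by
    simp [boxProd_adj, pathGraph_adj]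
  have hr (i : Fin 4) (j : Fin 2) := (hc _ _ (hrow i j)).1
  have hv (i : Fin 3) (j : Fin 3) := (hc _ _ (hcol i j)).1
  have hface (i : Fin 3) (j : Fin 2) :=
    (quadSign_eq_quadSign_k4Sign hq (hr i.castSucc j) (hv i j.succ) (hr i.succ j).symm
      (hv i j.castSucc).symm).symm.trans
    (quadSign_eq_of_switch (fun u v huv => (hc u v huv).2) (hrow i.castSucc j) (hcol i j.succ)
      (hrow i.succ j).symm (hcol i j.castSucc).symm)
  have hface' (i : Fin 3) (j : Fin 2) :=
    (quadSign_eq_quadSign_k4Sign hq (hr i.succ j) (hv i j.succ).symm (hr i.castSucc j).symm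
      (hv i j.castSucc)).symm.trans
    (quadSign_eq_of_switch (fun u v huv => (hc u v huv).2) (hrow i.succ j) (hcol i j.succ).symm
      (hrow i.castSucc j).symm (hcol i j.castSucc))
  have h₁ := evenlyJoined_k4Sign _ _ _ _ _ _ _ _ (hv 0 1) _ (hr 0 0) _ (hr 1 0) (hv 0 0)
    ((hface 0 0).trans (by decide)) _ (hr 0 1) _ (hr 1 1) (hv 0 2)
    ((hface 0 1).trans (by decide))
  have h₂ := evenlyJoined_k4Sign _ _ _ _ _ _ _ _ (hv 2 1).symm _ (hr 3 0) _ (hr 2 0)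
    (hv 2 0).symm ((hface' 2 0).trans (by decide)) _ (hr 3 1) _ (hr 2 1) (hv 2 2).symm
    ((hface' 2 1).trans (by decide))
  have h₃ := quadSign_k4Sign_of_evenlyJoined _ _ _ _ _ _ _ _ h₁ _ _ h₂ (hv 1 0) (hv 1 2) _
    (hr 1 0) (hr 1 1) _ (hv 1 1) (hr 2 0) (hr 2 1) ((hface 1 0).trans (by decide))
  exact absurd ((hface 1 1).symm.trans h₃) (by decide)

theorem exists_sHom_gridSignature_fin_five :
    ∃ (H : SimpleGraph (Fin 5)) (π : Fin 5 → Fin 5 → Bool),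
      SHom (pathGraph 4 □ pathGraph 3) gridSignature H π := by
  let f : Fin 4 × Fin 3 → Fin 5 := fun p =>
    (![![0, 1, 0], ![3, 2, 3], ![2, 1, 0], ![0, 3, 4]] : Fin 4 → Fin 3 → Fin 5) p.1 p.2
  let s : Fin 4 × Fin 3 → Bool := fun p => decide (p.2 = 1 ∨ p = (3, 0))
  let π : Fin 5 → Fin 5 → Bool := fun a b =>
    decide (s(a, b) ∈ ({s(0, 1), s(0, 2)} : Finset (Sym2 (Fin 5))))
  have key : ∀ u v : Fin 4 × Fin 3,
      ((u.1.val + 1 = v.1.val ∨ v.1.val + 1 = u.1.val) ∧ u.2 = v.2 ∨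
        (u.2.val + 1 = v.2.val ∨ v.2.val + 1 = u.2.val) ∧ u.1 = v.1) →
      f u ≠ f v ∧ π (f u) (f v) = xor (gridSignature u v) (xor (s u) (s v)) := by
    decide +kernel
  have hadj (u v) (h : (pathGraph 4 □ pathGraph 3).Adj u v) := key u v (by
    simpa only [boxProd_adj, pathGraph_adj] using h)
  exact ⟨⊤, π, ⟨f, fun {u v} h => (hadj u v h).1⟩, _, ⟨s, fun _ _ _ => rfl⟩,
    fun u v h => (hadj u v h).2⟩

/-- There is a signed grid on `P₄ □ P₃` with chromatic number exactly `5`. -/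
theorem exists_signed_grid_chrom_five :
    ∃ σ : Fin 4 × Fin 3 → Fin 4 × Fin 3 → Bool,
      (∀ p q, σ p q = σ q p) ∧ sChrom (pathGraph 4 □ pathGraph 3) σ = 5 := by
  refine ⟨gridSignature, gridSignature_comm, le_antisymm
    (Nat.sInf_le exists_sHom_gridSignature_fin_five)
    (le_csInf ⟨5, exists_sHom_gridSignature_fin_five⟩ ?_)⟩
  rintro n ⟨H, π, h⟩
  exact four_lt_of_sHom_gridSignature h
end

section
/- Let (A,π_A) and (B,π_B) be connected signed graphs and let σ be a signature on the Cartesian product graph A □ B (whose vertex set is V(A) × V(B)). For b ∈ V(B), the A-layer at b is the signature on A induced by σ via a ↦ (a,b); for a ∈ V(A), the B-layer at a is the signature on B induced by σ via b ↦ (a,b). Then σ is equivalent to the product signature of (A,π_A) □ (B,π_B) if and only if: (1) for every b ∈ V(B), the A-layer at b is equivalent to π_A; (2) for at least one a ∈ V(A), the B-layer at a is equivalent to π_B; and (3) for every edge aa' of A and every edge bb' of B, the 4-cycle (a,b),(a',b),(a',b'),(a,b') is balanced, i.e., σ((a,b)(a',b))·σ((a',b)(a',b'))·σ((a',b')(a,b'))·σ((a,b')(a,b))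 = +1. -/
open SimpleGraph

/-- A function that agrees on adjacent vertices of a preconnected graph is constant. -/
theorem eq_of_preconnected_of_adj {V X : Type*} {G : SimpleGraph V} (hG : G.Preconnected)
    {f : V → X} (hf : ∀ u v, G.Adj u v → f u = f v) (u v : V) : f u = f v := by
  obtain ⟨w⟩ := hG u v
  induction w with
  | nil => rfl
  | cons h _ ih => exact (hf _ _ h).trans ih

theorem Bool.eq_xor_of_eq_xor {x y z : Bool} (h : x = xor y z) : y = xor x z := by
  simp [h]

theorem prodSign_left {V W : Type*} [DecidableEq V] (σ : V → V → Bool) (π : W → W → Bool)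
    {a a' : V} (h : a ≠ a') (b b' : W) : prodSign σ π (a, b) (a', b') = σ a a' :=
  if_neg h

theorem prodSign_right {V W : Type*} [DecidableEq V] (σ : V → V → Bool) (π : W → W → Bool)
    (a : V) (b b' : W) : prodSign σ π (a, b) (a, b') = π b b' :=
  if_pos rfl

/-- A signature `σ` on `A □ B` is equivalent to the product signature of
`(A, πA) □ (B, πB)` iff every `A`-layer is equivalent to `πA`, some `B`-layer
is equivalent to `πB`, and every `4`-cycle between two copies of an edge of
`A` is balanced. -/
theorem sigEquiv_prodSign_iff
    {α β : Type} [Fintype α] [Fintype β] [DecidableEq α] [DecidableEq β]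
    (A : SimpleGraph α) (πA : α → α → Bool) (hπA : ∀ u v, πA u v = πA v u)
    (B : SimpleGraph β) (πB : β → β → Bool) (hπB : ∀ u v, πB u v = πB v u)
    (hA : A.Connected) (hB : B.Connected)
    (σ : α × β → α × β → Bool) (hσ : ∀ p q, σ p q = σ q p) :
    SigEquiv (A □ B) σ (prodSign πA πB) ↔
      ((∀ b : β, SigEquiv A (fun a a' => σ (a, b) (a', b)) πA) ∧
       (∃ a : α, SigEquiv B (fun b b' => σ (a, b) (a, b')) πB) ∧
       (∀ a a' : α, ∀ b b' : β, A.Adj a a' → B.Adj b b' →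
          xor (σ (a, b) (a', b))
            (xor (σ (a', b) (a', b'))
              (xor (σ (a', b') (a, b')) (σ (a, b') (a, b)))) = false)) := by
  constructor
  · rintro ⟨s, hs⟩
    have hsA (a a' : α) (b : β) (h : A.Adj a a') :
        πA a a' = xor (σ (a, b) (a', b)) (xor (s (a, b)) (s (a', b))) := by
      rw [← hs _ _ (boxProd_adj_left.2 h), prodSign_left _ _ h.ne]
    have hsB (a : α) (b b' : β) (h : B.Adj b b') :
        πB b b' = xor (σ (a, b) (a, b')) (xor (s (a, b)) (s (a, b'))) := by
      rw [← hs _ _ (boxProd_adj_right.2 h), prodSign_right]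
    obtain ⟨a₀⟩ := hA.nonempty
    refine ⟨fun b => ⟨fun a => s (a, b), fun a a' h => hsA a a' b h⟩,
      ⟨a₀, fun b => s (a₀, b), fun b b' h => hsB a₀ b b' h⟩, fun a a' b b' ha hb => ?_⟩
    have h₁ := Bool.eq_xor_of_eq_xor (hsA a a' b ha)
    have h₂ := Bool.eq_xor_of_eq_xor (hsA a a' b' ha)
    have h₃ := Bool.eq_xor_of_eq_xor (hsB a b b' hb)
    have h₄ := Bool.eq_xor_of_eq_xor (hsB a' b b' hb)
    rw [hσ (a', b') (a, b'), hσ (a, b') (a, b), h₁, h₂, h₃, h₄]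
    simp [Bool.xor_comm, Bool.xor_left_comm]
  · rintro ⟨hlayer, ⟨a₀, r, hr⟩, hbal⟩
    choose s hs using hlayer
    -- Normalize the switching of each `A`-layer so that it agrees with `r` at `a₀`.
    let t : α × β → Bool := fun p => xor (s p.2 p.1) (xor (s p.2 a₀) (r p.2))
    refine ⟨t, ?_⟩
    rintro ⟨a, b⟩ ⟨a', b'⟩ h
    rcases boxProd_adj.1 h with ⟨ha, hb⟩ | ⟨hb, ha⟩
    · obtain rfl : b = b' := hb
      rw [prodSign_left _ _ ha.ne, hs b a a' ha]
      simp [t, Bool.xor_comm, Bool.xor_left_comm]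
    · obtain rfl : a = a' := ha
      rw [prodSign_right]
      have hconst := eq_of_preconnected_of_adj hA.preconnected
        (f := fun x => xor (σ (x, b) (x, b')) (xor (t (x, b)) (t (x, b')))) (fun x y hxy => by
          have h₁ : σ (x, b) (y, b) = _ := Bool.eq_xor_of_eq_xor (hs b x y hxy)
          have h₂ : σ (x, b') (y, b') = _ := Bool.eq_xor_of_eq_xor (hs b' x y hxy)
          have h₃ := Bool.eq_xor_of_eq_xor (hbal x y b b' hxy hb).symm
          rw [hσ (y, b') (x, b'), hσ (x, b') (x, b), Bool.false_xor] at h₃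
          have h₄ := Bool.eq_xor_of_eq_xor h₃
          rw [h₄, h₁, h₂]
          simp [t, Bool.xor_comm, Bool.xor_left_comm]) a a₀
      refine Eq.trans ?_ hconst.symm
      rw [hr b b' hb]
      simp [t]
end

section
/- Every connected signed graph (G,σ) admits a prime s-decomposition, and this prime s-decomposition is unique up to the order of the factors and switching-isomorphism of the factors. Moreover, viewing the prime s-decomposition as a decomposition of the underlying graph G, the (unique) prime factor decomposition of the ordinary graph G with respect to the Cartesian product is finer than it. -/
open SimpleGraph

/-- A (finite) signed graph, bundled. -/
structure SGraph : Type 1 where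
  V : Type
  [fintypeV : Fintype V]
  [decEqV : DecidableEq V]
  graph : SimpleGraph V
  sign : V → V → Bool
  sign_symm : ∀ u v, sign u v = sign v u

attribute [instance] SGraph.fintypeV SGraph.decEqV

/-- Cartesian product of bundled signed graphs. -/
def SGraph.box (G H : SGraph) : SGraph where
  V := G.V × H.V
  graph := G.graph □ H.graph
  sign := fun p q => if p.1 = q.1 then H.sign p.2 q.2 else G.sign p.1 q.1
  sign_symm := by
    intro u v
    show (if u.1 = v.1 then _ else _) = (if v.1 = u.1 then _ else _)
    by_cases h : u.1 = v.1
    · rw [if_pos h, if_pos h.symm, H.sign_symm]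
    · rw [if_neg h, if_neg (fun hh => h hh.symm), G.sign_symm]

/-- The one-vertex signed graph (the unit of the Cartesian product up to
switching isomorphism). -/
def SGraph.unit : SGraph where
  V := Fin 1
  graph := ⊥
  sign := fun _ _ => false
  sign_symm := fun _ _ => rfl

/-- Iterated Cartesian product of a list of signed graphs. -/
def SGraph.listProd (l : List SGraph) : SGraph := l.foldr SGraph.box SGraph.unit

/-- Switching isomorphism of bundled signed graphs. -/
def SGraph.SwitchIso (G H : SGraph) : Prop :=
  ∃ (e : G.graph ≃g H.graph) (s : G.V → Bool),
    ∀ u v, G.graph.Adj u v → H.sign (e u) (e v) = xor (G.sign u v) (xor (s u) (s v))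

def SGraph.HasEdge (G : SGraph) : Prop := ∃ u v, G.graph.Adj u v

/-- `D` is an s-decomposition of `G`: a multiset of signed graphs, each with at
least one edge, whose Cartesian product is switching-isomorphic to `G`. -/
def SGraph.IsSDecomp (G : SGraph) (D : Multiset SGraph) : Prop :=
  (∀ H ∈ D, H.HasEdge) ∧
  ∃ l : List SGraph, (l : Multiset SGraph) = D ∧ G.SwitchIso (SGraph.listProd l)

/-- A signed graph is s-prime if it is not switching-isomorphic to the
Cartesian product of two signed graphs each on at least two vertices. -/
def SGraph.SPrime (G : SGraph) : Prop :=
  ¬ ∃ A B : SGraph, 2 ≤ Fintype.card A.V ∧ 2 ≤ Fintype.card B.V ∧ G.SwitchIso (A.box B)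

/-- A prime s-decomposition: an s-decomposition all of whose factors are
s-prime. -/
def SGraph.IsPrimeSDecomp (G : SGraph) (D : Multiset SGraph) : Prop :=
  G.IsSDecomp D ∧ ∀ H ∈ D, H.SPrime

/-- A (finite) ordinary graph, bundled. -/
structure FGraph : Type 1 where
  V : Type
  [fintypeV : Fintype V]
  graph : SimpleGraph V

attribute [instance] FGraph.fintypeV

/-- Cartesian product of bundled graphs. -/
def FGraph.box (G H : FGraph) : FGraph where
  V := G.V × H.V
  graph := G.graph □ H.graph

def FGraph.unit : FGraph where
  V := Fin 1
  graph := ⊥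

def FGraph.listProd (l : List FGraph) : FGraph := l.foldr FGraph.box FGraph.unit

def FGraph.Iso (G H : FGraph) : Prop := Nonempty (G.graph ≃g H.graph)

def FGraph.HasEdge (G : FGraph) : Prop := ∃ u v, G.graph.Adj u v

/-- `D` is a decomposition of the ordinary graph `G`. -/
def FGraph.IsDecomp (G : FGraph) (D : Multiset FGraph) : Prop :=
  (∀ H ∈ D, H.HasEdge) ∧
  ∃ l : List FGraph, (l : Multiset FGraph) = D ∧ G.Iso (FGraph.listProd l)

/-- An ordinary graph is prime if it is not isomorphic to the Cartesian
product of two graphs each on at least two vertices. -/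
def FGraph.Prime (G : FGraph) : Prop :=
  ¬ ∃ A B : FGraph, 2 ≤ Fintype.card A.V ∧ 2 ≤ Fintype.card B.V ∧ G.Iso (A.box B)

def FGraph.IsPrimeDecomp (G : FGraph) (D : Multiset FGraph) : Prop :=
  G.IsDecomp D ∧ ∀ H ∈ D, H.Prime

/-- `D'` is finer than `D`: every factor of `D` can be decomposed so that `D'`
is the multiset union of these decompositions. -/
def FGraph.Finer (D' D : Multiset FGraph) : Prop :=
  ∃ p : Multiset (FGraph × Multiset FGraph),
    p.map Prod.fst = D ∧ (p.map Prod.snd).sum = D' ∧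
    ∀ x ∈ p, FGraph.IsDecomp x.1 x.2

/-- The underlying (unsigned) graph of a bundled signed graph. -/
def SGraph.forget (G : SGraph) : FGraph := { V := G.V, graph := G.graph }

namespace SGraph

/-- An isomorphism of underlying graphs respects the signatures up to switching. -/
def IsSwitch {G H : SGraph} (e : G.graph ≃g H.graph) : Prop :=
  ∃ s : G.V → Bool,
    ∀ u v, G.graph.Adj u v → H.sign (e u) (e v) = xor (G.sign u v) (xor (s u) (s v))

theorem IsSwitch.switchIso {G H : SGraph} {e : G.graph ≃g H.graph} (h : IsSwitch e) :
    G.SwitchIso H := ⟨e, h⟩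

theorem IsSwitch.trans {G H K : SGraph} {e : G.graph ≃g H.graph} {f : H.graph ≃g K.graph}
    (he : IsSwitch e) (hf : IsSwitch f) : IsSwitch (e.trans f) := by
  obtain ⟨s, hs⟩ := he
  obtain ⟨t, ht⟩ := hf
  refine ⟨fun v => xor (s v) (t (e v)), fun u v huv => ?_⟩
  have h1 := hs u v huv
  have h2 := ht (e u) (e v) (e.map_rel_iff.2 huv)
  simp only [RelIso.trans_apply, h2, h1]
  generalize G.sign u v = x
  generalize s u = x1
  generalize s v = x2
  generalize t (e u) = x3
  generalize t (e v) = x4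
  revert x x1 x2 x3 x4
  decide

theorem IsSwitch.symm {G H : SGraph} {e : G.graph ≃g H.graph}
    (he : IsSwitch e) : IsSwitch (G := H) (H := G) e.symm := by
  obtain ⟨s, hs⟩ := he
  refine ⟨fun v => s (e.symm v), fun u v huv => ?_⟩
  have h1 := hs (e.symm u) (e.symm v) (e.symm.map_rel_iff.2 huv)
  simp only [RelIso.apply_symm_apply] at h1
  simp only [h1]
  generalize G.sign (e.symm u) (e.symm v) = x
  generalize s (e.symm u) = x1
  generalize s (e.symm v) = x2
  revert x x1 x2
  decide

theorem SwitchIso.refl (G : SGraph) : G.SwitchIso G :=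
  ⟨SimpleGraph.Iso.refl, fun _ => false, fun _ _ _ => by simp⟩

theorem SwitchIso.symm {G H : SGraph} : G.SwitchIso H → H.SwitchIso G :=
  fun ⟨_, h⟩ => (IsSwitch.symm h).switchIso

theorem SwitchIso.trans {G H K : SGraph} : G.SwitchIso H → H.SwitchIso K → G.SwitchIso K :=
  fun ⟨_, h⟩ ⟨_, h'⟩ => (IsSwitch.trans h h').switchIso

theorem SwitchIso.card_eq {G H : SGraph} : G.SwitchIso H → Fintype.card G.V = Fintype.card H.V :=
  fun ⟨e, _⟩ => Fintype.card_congr e.toEquiv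

theorem SwitchIso.connected {G H : SGraph} : G.SwitchIso H → G.graph.Connected →
    H.graph.Connected :=
  fun ⟨e, _⟩ h => e.connected_iff.1 h

theorem card_box (A B : SGraph) :
    Fintype.card (A.box B).V = Fintype.card A.V * Fintype.card B.V :=
  Fintype.card_prod _ _

theorem connected_box {A B : SGraph} :
    (A.box B).graph.Connected ↔ A.graph.Connected ∧ B.graph.Connected :=
  connected_boxProd

theorem box_adj {A B : SGraph} {p q : A.V × B.V} :
    (A.box B).graph.Adj p q ↔
      A.graph.Adj p.1 q.1 ∧ p.2 = q.2 ∨ B.graph.Adj p.2 q.2 ∧ p.1 = q.1 :=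
  boxProd_adj

theorem box_sign_left {A B : SGraph} {p q : A.V × B.V} (h : A.graph.Adj p.1 q.1) :
    (A.box B).sign p q = A.sign p.1 q.1 := if_neg h.ne

theorem box_sign_right {A B : SGraph} {p q : A.V × B.V} (h : p.1 = q.1) :
    (A.box B).sign p q = B.sign p.2 q.2 := if_pos h

/-- The isomorphism swapping the two factors. -/
def boxComm (A B : SGraph) : (A.box B).graph ≃g (B.box A).graph :=
  boxProdComm A.graph B.graph

theorem isSwitch_boxComm (A B : SGraph) : IsSwitch (boxComm A B) := by
  refine ⟨fun _ => false, fun u v huv => ?_⟩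
  rw [show boxComm A B u = (u.2, u.1) from rfl, show boxComm A B v = (v.2, v.1) from rfl]
  rcases box_adj.1 huv with ⟨h, h'⟩ | ⟨h, h'⟩
  · rw [box_sign_left h, box_sign_right h']
    simp
  · rw [box_sign_right h', box_sign_left (A := B) h]
    simp

theorem box_comm (A B : SGraph) : (A.box B).SwitchIso (B.box A) :=
  (isSwitch_boxComm A B).switchIso

theorem box_congr {A B A' B' : SGraph} (hA : A.SwitchIso A') (hB : B.SwitchIso B') :
    (A.box B).SwitchIso (A'.box B') := by
  obtain ⟨e, s, hs⟩ := hA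
  obtain ⟨f, t, ht⟩ := hB
  refine ⟨⟨Equiv.prodCongr e.toEquiv f.toEquiv, ?_⟩, fun p => xor (s p.1) (t p.2), ?_⟩
  · rintro ⟨a, b⟩ ⟨a', b'⟩
    refine Iff.trans (box_adj (A := A') (B := B') (p := (e a, f b)) (q := (e a', f b'))) ?_
    refine Iff.trans ?_ (box_adj (A := A) (B := B) (p := (a, b)) (q := (a', b'))).symm
    exact or_congr (and_congr e.map_rel_iff f.injective.eq_iff)
      (and_congr f.map_rel_iff e.injective.eq_iff)
  · rintro ⟨a, b⟩ ⟨a', b'⟩ hpq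
    change (A'.box B').sign (e a, f b) (e a', f b') =
      xor ((A.box B).sign (a, b) (a', b')) (xor (xor (s a) (t b)) (xor (s a') (t b')))
    rcases box_adj.1 hpq with ⟨h, h' : b = b'⟩ | ⟨h, h' : a = a'⟩
    · subst h'
      rw [box_sign_left (A := A') (e.map_rel_iff.2 h), box_sign_left (A := A) h, hs _ _ h]
      cases s a <;> cases s a' <;> cases t b <;> simp
    · subst h'
      rw [box_sign_right (A := A') (p := (e a, f b)) (q := (e a, f b')) rfl,
        box_sign_right (A := A) (p := (a, b)) (q := (a, b')) rfl, ht _ _ h]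
      cases s a <;> cases t b <;> cases t b' <;> simp

theorem box_assoc (A B C : SGraph) : ((A.box B).box C).SwitchIso (A.box (B.box C)) := by
  refine ⟨boxProdAssoc A.graph B.graph C.graph, fun _ => false, ?_⟩
  rintro ⟨⟨a, b⟩, c⟩ ⟨⟨a', b'⟩, c'⟩ h
  change (A.box (B.box C)).sign (a, (b, c)) (a', (b', c')) = _
  simp only [box, Prod.mk.injEq]
  by_cases h1 : a = a' <;> by_cases h2 : b = b' <;> simp [h1, h2]

theorem box_card_one (A : SGraph) {B : SGraph} (hB : Fintype.card B.V = 1) :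
    (A.box B).SwitchIso A := by
  obtain ⟨b, hb⟩ := Fintype.card_eq_one_iff.1 hB
  have hsub : Subsingleton B.V := ⟨fun x y => (hb x).trans (hb y).symm⟩
  refine ⟨⟨⟨Prod.fst, fun a => (a, b), fun p => Prod.ext rfl (Subsingleton.elim _ _),
    fun _ => rfl⟩, ?_⟩, fun _ => false, ?_⟩
  · intro p q
    refine Iff.trans ?_ (box_adj (A := A) (B := B) (p := p) (q := q)).symm
    constructor
    · exact fun h => Or.inl ⟨h, Subsingleton.elim _ _⟩
    · rintro (h | h)
      · exact h.1
      · exact absurd (Subsingleton.elim _ _) h.1.ne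
  · intro p q hpq
    change A.sign p.1 q.1 = _
    rcases box_adj.1 hpq with h | h
    · rw [box_sign_left h.1]
      simp
    · exact absurd (Subsingleton.elim _ _) h.1.ne

theorem card_one_box {A : SGraph} (B : SGraph) (hA : Fintype.card A.V = 1) :
    (A.box B).SwitchIso B :=
  (box_comm A B).trans (box_card_one B hA)

theorem card_unit : Fintype.card unit.V = 1 := rfl

theorem listProd_append (l m : List SGraph) :
    ((listProd l).box (listProd m)).SwitchIso (listProd (l ++ m)) := by
  induction l with
  | nil => exact card_one_box _ card_unit
  | cons a l ih => exact (box_assoc _ _ _).trans (box_congr (SwitchIso.refl a) ih)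

theorem listProd_singleton (G : SGraph) : (listProd [G]).SwitchIso G :=
  box_card_one G card_unit

/-- The signed subgraph induced on a set of vertices. -/
noncomputable def induce (G : SGraph) (S : Set G.V) : SGraph where
  V := S
  fintypeV := Fintype.ofFinite S
  decEqV := Classical.decEq _
  graph := G.graph.induce S
  sign := fun u v => G.sign u v
  sign_symm := fun u v => G.sign_symm u v

end SGraph

theorem SimpleGraph.Hom.edist_le {α β : Type*} {G : SimpleGraph α} {H : SimpleGraph β}
    (f : G →g H) (u v : α) : H.edist (f u) (f v) ≤ G.edist u v := by
  refine le_iInf fun w => ?_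
  simpa using SimpleGraph.edist_le (w.map f)

theorem SimpleGraph.Iso.edist_eq {α β : Type*} {G : SimpleGraph α} {H : SimpleGraph β}
    (e : G ≃g H) (u v : α) : H.edist (e u) (e v) = G.edist u v := by
  refine le_antisymm (e.toHom.edist_le u v) ?_
  simpa using e.symm.toHom.edist_le (e u) (e v)

/-- The image of a layer under an isomorphism between connected Cartesian products is a box. -/
theorem exists_layer_eq_mk {α β γ δ : Type*} {A : SimpleGraph α} {B : SimpleGraph β}
    {C : SimpleGraph γ} {D : SimpleGraph δ} (hc : (A.boxProd B).Connected)
    (e : A.boxProd B ≃g C.boxProd D) (b : β) (a₁ a₂ : α) :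
    ∃ a, e (a, b) = ((e (a₁, b)).1, (e (a₂, b)).2) := by
  have he : ∀ p q, (C.boxProd D).edist (e p) (e q) = (A.boxProd B).edist p q := fun p q => e.edist_eq p q
  obtain ⟨⟨a, b'⟩, hm⟩ := e.surjective ((e (a₁, b)).1, (e (a₂, b)).2)
  have h1 := he (a₁, b) (a, b')
  have h2 := he (a, b') (a₂, b)
  have h3 := he (a₁, b) (a₂, b)
  rw [hm] at h1 h2
  simp only [edist_boxProd, edist_self, zero_add, add_zero] at h1 h2 h3
  have h4 : A.edist a₁ a₂ ≤ A.edist a₁ a + A.edist a a₂ := SimpleGraph.edist_triangle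
  have hsum : A.edist a₁ a₂ = (A.edist a₁ a + B.edist b b') + (A.edist a a₂ + B.edist b' b) := by
    rw [← h1, ← h2, ← h3, add_comm]
  have hA := hc.ofBoxProdLeft
  have hB := hc.ofBoxProdRight
  have fA : ∀ x y, A.edist x y = (A.dist x y : ℕ∞) := fun x y =>
    ((hA x y).coe_dist_eq_edist).symm
  have fB : ∀ x y, B.edist x y = (B.dist x y : ℕ∞) := fun x y =>
    ((hB x y).coe_dist_eq_edist).symm
  simp only [fA, fB] at h4 hsum
  norm_cast at h4 hsum
  have h0 : B.dist b b' = 0 := by omega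
  obtain rfl := (hB.dist_eq_zero_iff).1 h0
  exact ⟨a, hm⟩

namespace SGraph

/-- If the vertices of `A` are mapped injectively onto a box inside `C □ D`, preserving the
signed graph structure up to switching, then `A` is the product of two of its layers. -/
theorem switchIso_box_of_image_box {A C D : SGraph} (f : A.V → C.V × D.V)
    (hinj : Function.Injective f)
    (hadj : ∀ a a', A.graph.Adj a a' ↔
      C.graph.Adj (f a).1 (f a').1 ∧ (f a).2 = (f a').2 ∨
        D.graph.Adj (f a).2 (f a').2 ∧ (f a).1 = (f a').1)
    (s : A.V → Bool)
    (hC : ∀ a a', C.graph.Adj (f a).1 (f a').1 → (f a).2 = (f a').2 →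
      C.sign (f a).1 (f a').1 = xor (A.sign a a') (xor (s a) (s a')))
    (hD : ∀ a a', D.graph.Adj (f a).2 (f a').2 → (f a).1 = (f a').1 →
      D.sign (f a).2 (f a').2 = xor (A.sign a a') (xor (s a) (s a')))
    (hmix : ∀ a₁ a₂, ∃ a, f a = ((f a₁).1, (f a₂).2)) (a₀ : A.V) :
    A.SwitchIso ((A.induce {a | (f a).2 = (f a₀).2}).box
      (A.induce {a | (f a).1 = (f a₀).1})) := by
  choose m hm using hmix
  have hadj₁ : ∀ a a', A.graph.Adj (m a a₀) (m a' a₀) ↔ C.graph.Adj (f a).1 (f a').1 := by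
    intro a a'
    simp [hadj, hm]
  have hadj₂ : ∀ a a', A.graph.Adj (m a₀ a) (m a₀ a') ↔ D.graph.Adj (f a).2 (f a').2 := by
    intro a a'
    simp [hadj, hm]
  have heq₁ : ∀ a a', m a a₀ = m a' a₀ ↔ (f a).1 = (f a').1 := by
    intro a a'
    rw [← hinj.eq_iff, hm, hm]
    simp
  have heq₂ : ∀ a a', m a₀ a = m a₀ a' ↔ (f a).2 = (f a').2 := by
    intro a a'
    rw [← hinj.eq_iff, hm, hm]
    simp
  let X : Set A.V := {a | (f a).2 = (f a₀).2}
  let Y : Set A.V := {a | (f a).1 = (f a₀).1}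
  let F : A.V → X × Y := fun a =>
    (⟨m a a₀, (congrArg Prod.snd (hm a a₀) :)⟩, ⟨m a₀ a, (congrArg Prod.fst (hm a₀ a) :)⟩)
  let E : A.V ≃ X × Y :=
    { toFun := F
      invFun := fun p => m p.1 p.2
      left_inv := fun a => hinj (by simp [F, hm])
      right_inv := by
        rintro ⟨⟨x, hx⟩, ⟨y, hy⟩⟩
        refine Prod.ext (Subtype.ext (hinj ?_)) (Subtype.ext (hinj ?_))
        · simp only [F, hm]
          exact Prod.ext rfl hx.symm
        · simp only [F, hm]
          exact Prod.ext hy.symm rfl }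
  refine ⟨⟨E, ?_⟩, fun a => xor (s a) (xor (s (m a a₀)) (s (m a₀ a))), ?_⟩
  · intro a a'
    refine (box_adj (A := A.induce X) (B := A.induce Y) (p := F a) (q := F a')).trans ?_
    rw [hadj]
    refine or_congr (and_congr (hadj₁ a a') ?_) (and_congr (hadj₂ a a') ?_)
    · exact Subtype.ext_iff.trans (heq₂ a a')
    · exact Subtype.ext_iff.trans (heq₁ a a')
  · intro a a' h
    change ((A.induce X).box (A.induce Y)).sign (F a) (F a') = _
    rcases (hadj a a').1 h with ⟨h1, h2⟩ | ⟨h1, h2⟩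
    · rw [box_sign_left (A := A.induce X) (B := A.induce Y) (p := F a) (q := F a') ((hadj₁ a a').2 h1)]
      change A.sign (m a a₀) (m a' a₀) = _
      have k1 := hC a a' h1 h2
      have k2 := hC (m a a₀) (m a' a₀) (by simpa [hm] using h1) (by simp [hm])
      simp only [hm] at k2
      beta_reduce
      rw [(heq₂ a a').2 h2]
      rw [k1] at k2
      revert k2
      cases A.sign a a' <;> cases A.sign (m a a₀) (m a' a₀) <;> cases s a <;> cases s a' <;>
        cases s (m a a₀) <;> cases s (m a' a₀) <;> cases s (m a₀ a') <;> simp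
    · rw [box_sign_right (A := A.induce X) (B := A.induce Y) (p := F a) (q := F a')
        (Subtype.ext ((heq₁ a a').2 h2))]
      change A.sign (m a₀ a) (m a₀ a') = _
      have k1 := hD a a' h1 h2
      have k2 := hD (m a₀ a) (m a₀ a') (by simpa [hm] using h1) (by simp [hm])
      simp only [hm] at k2
      beta_reduce
      rw [(heq₁ a a').2 h2]
      rw [k1] at k2
      revert k2
      cases A.sign a a' <;> cases A.sign (m a₀ a) (m a₀ a') <;> cases s a <;> cases s a' <;>
        cases s (m a₀ a) <;> cases s (m a₀ a') <;> cases s (m a' a₀) <;> simp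

theorem IsSwitch.layer_left {A B C D : SGraph} {e : (A.box B).graph ≃g (C.box D).graph}
    (he : IsSwitch e) (b : B.V) : ∃ s : A.V → Bool, ∀ a a', A.graph.Adj a a' →
      (C.box D).sign (e (a, b)) (e (a', b)) = xor (A.sign a a') (xor (s a) (s a')) := by
  obtain ⟨s, hs⟩ := he
  refine ⟨fun a => s (a, b), fun a a' h => ?_⟩
  refine (hs (a, b) (a', b) (box_adj.2 (Or.inl ⟨h, rfl⟩))).trans ?_
  rw [box_sign_left (A := A) (p := (a, b)) (q := (a', b)) h]

theorem layer_adj_iff {A B C D : SGraph} (e : (A.box B).graph ≃g (C.box D).graph) (b : B.V)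
    (a a' : A.V) : A.graph.Adj a a' ↔
      C.graph.Adj (e (a, b)).1 (e (a', b)).1 ∧ (e (a, b)).2 = (e (a', b)).2 ∨
        D.graph.Adj (e (a, b)).2 (e (a', b)).2 ∧ (e (a, b)).1 = (e (a', b)).1 := by
  refine Iff.trans ?_ (box_adj (A := C) (B := D) (p := e (a, b)) (q := e (a', b)))
  refine Iff.trans ?_ (e.map_rel_iff (a := (a, b)) (b := (a', b))).symm
  exact boxProd_adj_left.symm

theorem IsSwitch.switchIso_box_layers {A B C D : SGraph}
    {e : (A.box B).graph ≃g (C.box D).graph} (he : IsSwitch e)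
    (hc : (A.box B).graph.Connected) (a₀ : A.V) (b : B.V) :
    A.SwitchIso ((A.induce {a | (e (a, b)).2 = (e (a₀, b)).2}).box
      (A.induce {a | (e (a, b)).1 = (e (a₀, b)).1})) := by
  obtain ⟨s, hs⟩ := he.layer_left b
  have hadj := layer_adj_iff e b
  refine switchIso_box_of_image_box (C := C) (D := D) (fun a => e (a, b))
    (fun a a' h => congrArg Prod.fst (e.injective h)) hadj s ?_ ?_
    (exists_layer_eq_mk hc e b) a₀
  · intro a a' h h'
    rw [← hs a a' ((hadj a a').2 (Or.inl ⟨h, h'⟩))]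
    exact (box_sign_left h).symm
  · intro a a' h h'
    rw [← hs a a' ((hadj a a').2 (Or.inr ⟨h, h'⟩))]
    exact (box_sign_right h').symm

theorem IsSwitch.induce_layer_switchIso {A B C D : SGraph}
    {e : (A.box B).graph ≃g (C.box D).graph} (he : IsSwitch e) (b : B.V) (d : D.V) :
    (A.induce {a | (e (a, b)).2 = d}).SwitchIso
      (C.induce {c | (e.symm (c, d)).2 = b}) := by
  obtain ⟨s, hs⟩ := he.layer_left b
  have hadj := layer_adj_iff e b
  have h1 : ∀ a, (e (a, b)).2 = d → e.symm ((e (a, b)).1, d) = (a, b) := by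
    rintro a rfl
    exact e.symm_apply_apply (a, b)
  have h2 : ∀ c, (e.symm (c, d)).2 = b → e ((e.symm (c, d)).1, b) = (c, d) := by
    rintro c rfl
    exact e.apply_symm_apply (c, d)
  let E : {a | (e (a, b)).2 = d} ≃ {c | (e.symm (c, d)).2 = b} :=
    { toFun := fun a => ⟨(e (a.1, b)).1, congrArg Prod.snd (h1 a.1 a.2)⟩
      invFun := fun c => ⟨(e.symm (c.1, d)).1, congrArg Prod.snd (h2 c.1 c.2)⟩
      left_inv := fun a => Subtype.ext (congrArg Prod.fst (h1 a.1 a.2))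
      right_inv := fun c => Subtype.ext (congrArg Prod.fst (h2 c.1 c.2)) }
  have hE : ∀ a a' : {a | (e (a, b)).2 = d},
      C.graph.Adj (e (a.1, b)).1 (e (a'.1, b)).1 ↔ A.graph.Adj a.1 a'.1 := by
    rintro ⟨a, ha⟩ ⟨a', ha'⟩
    have hd : (e (a, b)).2 = (e (a', b)).2 := ha.trans ha'.symm
    rw [hadj a a']
    constructor
    · exact fun h => Or.inl ⟨h, hd⟩
    · rintro (h | h)
      · exact h.1
      · exact absurd hd h.1.ne
  refine ⟨⟨E, fun {a a'} => hE a a'⟩, fun a => s a.1, ?_⟩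
  intro a a' h
  change C.sign (e (a.1, b)).1 (e (a'.1, b)).1 = _
  refine Eq.trans ?_ (hs a.1 a'.1 h)
  exact (box_sign_left ((hE a a').2 h)).symm

/-- Any two binary factorizations of a connected signed graph have a common refinement. -/
theorem box_refinement {A B C D : SGraph} (hc : (A.box B).graph.Connected)
    (h : (A.box B).SwitchIso (C.box D)) :
    ∃ X Y Z W : SGraph, A.SwitchIso (X.box Y) ∧ B.SwitchIso (Z.box W) ∧
      C.SwitchIso (X.box Z) ∧ D.SwitchIso (Y.box W) := by
  have hc' := h.connected hc
  obtain ⟨e, he⟩ := h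
  change IsSwitch e at he
  obtain ⟨⟨a, b⟩⟩ := hc.nonempty
  obtain ⟨⟨c, d⟩, hcd⟩ : ∃ p : C.V × D.V, e (a, b) = p := ⟨_, rfl⟩
  have hab : e.symm (c, d) = (a, b) := by
    rw [← hcd]
    exact e.symm_apply_apply (a, b)
  have hswapAB := isSwitch_boxComm B A
  have hswapCD := isSwitch_boxComm C D
  have hswapDC := isSwitch_boxComm D C
  have hA := he.switchIso_box_layers hc a b
  have hB := (hswapAB.trans he).switchIso_box_layers
    (((boxComm B A).connected_iff).2 hc) b a
  have hC := he.symm.switchIso_box_layers hc' c d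
  have hD := (hswapDC.trans he.symm).switchIso_box_layers
    (((boxComm D C).connected_iff).2 hc') d c
  have hB' : B.SwitchIso ((B.induce {y | (e (a, y)).2 = (e (a, b)).2}).box
      (B.induce {y | (e (a, y)).1 = (e (a, b)).1})) := hB
  have hD' : D.SwitchIso ((D.induce {y | (e.symm (c, y)).2 = (e.symm (c, d)).2}).box
      (D.induce {y | (e.symm (c, y)).1 = (e.symm (c, d)).1})) := hD
  rw [hcd] at hA hB'
  rw [hab] at hC hD'
  refine ⟨_, _, _, _, hA, hB', hC.trans (box_congr ?_ ?_), hD'.trans (box_congr ?_ ?_)⟩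
  · exact (he.induce_layer_switchIso b d).symm
  · exact ((hswapAB.trans he).induce_layer_switchIso a d).symm
  · exact ((he.trans hswapCD).induce_layer_switchIso b c).symm
  · exact (((hswapAB.trans he).trans hswapCD).induce_layer_switchIso a c).symm

end SGraph

namespace SGraph

theorem HasEdge.two_le_card {G : SGraph} : G.HasEdge → 2 ≤ Fintype.card G.V :=
  fun ⟨u, v, h⟩ => Fintype.one_lt_card_iff.2 ⟨u, v, h.ne⟩

theorem hasEdge_of_connected {G : SGraph} (hc : G.graph.Connected)
    (h : 2 ≤ Fintype.card G.V) : G.HasEdge := by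
  have : Nontrivial G.V := Fintype.one_lt_card_iff_nontrivial.1 h
  obtain ⟨v⟩ := hc.nonempty
  obtain ⟨w, hw⟩ := hc.preconnected.exists_adj_of_nontrivial v
  exact ⟨v, w, hw⟩

theorem SPrime.card_eq_one {P A B : SGraph} (hP : P.SPrime) (h : P.SwitchIso (A.box B))
    (hc : (A.box B).graph.Connected) : Fintype.card A.V = 1 ∨ Fintype.card B.V = 1 := by
  obtain ⟨hA, hB⟩ := connected_box.1 hc
  have hA' : 0 < Fintype.card A.V := Fintype.card_pos_iff.2 hA.nonempty
  have hB' : 0 < Fintype.card B.V := Fintype.card_pos_iff.2 hB.nonempty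
  by_contra! hne
  exact hP ⟨A, B, by omega, by omega, h⟩

/-- An `s`-prime factor of a product of `s`-primes is one of these, and can be cancelled. -/
theorem SPrime.exists_perm_cons {P : SGraph} (hP : P.SPrime) (hP2 : 2 ≤ Fintype.card P.V)
    (l : List SGraph) : ∀ Q : SGraph, (∀ H ∈ l, H.SPrime ∧ H.HasEdge) →
      (P.box Q).graph.Connected → (P.box Q).SwitchIso (listProd l) →
      ∃ (H : SGraph) (m : List SGraph), l.Perm (H :: m) ∧ P.SwitchIso H ∧
        Q.SwitchIso (listProd m) := by
  induction l with
  | nil =>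
    intro Q _ _ h
    have hcard := (card_box P Q).symm.trans (h.card_eq.trans card_unit)
    have := Nat.eq_one_of_mul_eq_one_right hcard
    omega
  | cons K l ih =>
    intro Q hl hc h
    obtain ⟨X, Y, Z, W, hPXY, hQ, hK, hL⟩ := box_refinement (C := K) (D := listProd l) hc h
    obtain ⟨hPc, hQc⟩ := connected_box.1 hc
    have hKl := (connected_box (A := K) (B := listProd l)).1 (h.connected hc)
    have hK' := hl K List.mem_cons_self
    rcases hP.card_eq_one hPXY (hPXY.connected hPc) with hX | hY
    · have hPY := hPXY.trans (card_one_box Y hX)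
      have hKZ := hK.trans (card_one_box Z hX)
      have hLP : (P.box W).SwitchIso (listProd l) :=
        (box_congr hPY (SwitchIso.refl W)).trans hL.symm
      obtain ⟨H, m, hperm, hPH, hW⟩ := ih W (fun H hH => hl H (List.mem_cons_of_mem _ hH))
        (hLP.symm.connected hKl.2) hLP
      exact ⟨H, K :: m, (hperm.cons K).trans (List.Perm.swap H K m), hPH,
        hQ.trans (box_congr hKZ.symm hW)⟩
    · have hPX := hPXY.trans (box_card_one X hY)
      have hX : Fintype.card X.V ≠ 1 := by
        have := hPX.card_eq
        omega
      have hZ := (hK'.1.card_eq_one hK (hK.connected hKl.1)).resolve_left hX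
      exact ⟨K, l, List.Perm.refl _, hPX.trans (hK.trans (box_card_one X hZ)).symm,
        (hQ.trans (card_one_box W hZ)).trans (hL.trans (card_one_box W hY)).symm⟩

theorem rel_switchIso_of_listProd (l : List SGraph) : ∀ m : List SGraph,
    (∀ H ∈ l, H.SPrime ∧ H.HasEdge) → (∀ H ∈ m, H.SPrime ∧ H.HasEdge) →
    (listProd l).graph.Connected → (listProd l).SwitchIso (listProd m) →
    Multiset.Rel SwitchIso (l : Multiset SGraph) (m : Multiset SGraph) := by
  induction l with
  | nil =>
    intro m _ hm hc h
    cases m with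
    | nil => exact Multiset.Rel.zero
    | cons K m =>
      have hcard := ((card_box K (listProd m)).symm.trans h.card_eq.symm).trans card_unit
      have := Nat.eq_one_of_mul_eq_one_right hcard
      have := (hm K List.mem_cons_self).2.two_le_card
      omega
  | cons P l ih =>
    intro m hl hm hc h
    have hP := hl P List.mem_cons_self
    obtain ⟨H, m', hperm, hPH, hlm⟩ :=
      hP.1.exists_perm_cons hP.2.two_le_card m (listProd l) hm hc h
    rw [Multiset.coe_eq_coe.2 hperm, ← Multiset.cons_coe, ← Multiset.cons_coe]
    refine Multiset.Rel.cons hPH (ih m' (fun K hK => hl K (List.mem_cons_of_mem _ hK))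
      (fun K hK => hm K (hperm.symm.subset (List.mem_cons_of_mem _ hK))) ?_ hlm)
    exact ((connected_box (A := P) (B := listProd l)).1 hc).2

theorem exists_prime_listProd {p : SGraph → Prop}
    (hp : ∀ G, p G → ¬ G.SPrime → ∃ A B : SGraph, 2 ≤ Fintype.card A.V ∧
      2 ≤ Fintype.card B.V ∧ p A ∧ p B ∧ G.SwitchIso (A.box B)) (n : ℕ) :
    ∀ G : SGraph, Fintype.card G.V = n → p G → G.graph.Connected →
      ∃ l : List SGraph, (∀ H ∈ l, p H ∧ H.SPrime ∧ H.HasEdge) ∧ G.SwitchIso (listProd l) := by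
  induction n using Nat.strong_induction_on with
  | _ n ih =>
    rintro G rfl hG hc
    have hpos : 0 < Fintype.card G.V := Fintype.card_pos_iff.2 hc.nonempty
    by_cases h1 : Fintype.card G.V = 1
    · exact ⟨[], by simp, (box_card_one G card_unit).symm.trans (card_one_box unit h1)⟩
    by_cases hprime : G.SPrime
    · refine ⟨[G], ?_, (listProd_singleton G).symm⟩
      simp only [List.mem_singleton, forall_eq]
      exact ⟨hG, hprime, hasEdge_of_connected hc (by omega)⟩
    · obtain ⟨A, B, hA, hB, hpA, hpB, h⟩ := hp G hG hprime
      have hcard := h.card_eq.trans (card_box A B)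
      obtain ⟨hcA, hcB⟩ := connected_box.1 (h.connected hc)
      obtain ⟨l, hl, hAl⟩ := ih _ (by nlinarith) A rfl hpA hcA
      obtain ⟨m, hm, hBm⟩ := ih _ (by nlinarith) B rfl hpB hcB
      refine ⟨l ++ m, fun H hH => ?_, (h.trans (box_congr hAl hBm)).trans (listProd_append l m)⟩
      exact (List.mem_append.1 hH).elim (hl H) (hm H)

theorem SwitchIso.forget {G H : SGraph} : G.SwitchIso H → G.forget.Iso H.forget :=
  fun ⟨e, _⟩ => ⟨e⟩

theorem forget_listProd (l : List SGraph) :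
    (listProd l).forget = FGraph.listProd (l.map SGraph.forget) := by
  induction l with
  | nil => rfl
  | cons A l ih => exact congrArg (FGraph.box A.forget) ih

theorem connected_of_mem_listProd {l : List SGraph} (h : (listProd l).graph.Connected) :
    ∀ H ∈ l, H.graph.Connected := by
  induction l with
  | nil => simp
  | cons A l ih =>
    have h' := (connected_box (A := A) (B := listProd l)).1 h
    exact List.forall_mem_cons.2 ⟨h'.1, ih h'.2⟩

end SGraph

namespace FGraph

open Classical in
/-- The signed graph all of whose edges are positive. -/
noncomputable def toSGraph (G : FGraph) : SGraph where
  V := G.V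
  graph := G.graph
  sign := fun _ _ => false
  sign_symm := fun _ _ => rfl

theorem Iso.toSGraph {G H : FGraph} : G.Iso H → G.toSGraph.SwitchIso H.toSGraph :=
  fun ⟨e⟩ => ⟨e, fun _ => false, fun _ _ _ => rfl⟩

theorem toSGraph_box (G H : FGraph) :
    (G.box H).toSGraph.SwitchIso (G.toSGraph.box H.toSGraph) :=
  ⟨SimpleGraph.Iso.refl, fun _ => false, fun _ _ _ => ite_self _⟩

theorem toSGraph_listProd (l : List FGraph) :
    (listProd l).toSGraph.SwitchIso (SGraph.listProd (l.map toSGraph)) := by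
  induction l with
  | nil => exact ⟨SimpleGraph.Iso.refl, fun _ => false, fun _ _ _ => rfl⟩
  | cons A l ih =>
    exact (toSGraph_box A (listProd l)).trans (SGraph.box_congr (SGraph.SwitchIso.refl _) ih)

theorem Iso.refl (G : FGraph) : G.Iso G := ⟨SimpleGraph.Iso.refl⟩

theorem Iso.symm {G H : FGraph} : G.Iso H → H.Iso G := fun ⟨e⟩ => ⟨e.symm⟩

theorem Iso.trans {G H K : FGraph} : G.Iso H → H.Iso K → G.Iso K :=
  fun ⟨e⟩ ⟨f⟩ => ⟨e.trans f⟩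

theorem box_congr {A B A' B' : FGraph} (hA : A.Iso A') (hB : B.Iso B') :
    (A.box B).Iso (A'.box B') :=
  (((toSGraph_box A B).trans (SGraph.box_congr hA.toSGraph hB.toSGraph)).trans
    (toSGraph_box A' B').symm).forget

theorem listProd_append (l m : List FGraph) :
    ((listProd l).box (listProd m)).Iso (listProd (l ++ m)) := by
  induction l with
  | nil => exact (SGraph.card_one_box (A := SGraph.unit) (listProd m).toSGraph rfl).forget
  | cons A l ih =>
    exact Iso.trans (H := A.box ((listProd l).box (listProd m)))
      ⟨boxProdAssoc A.graph (listProd l).graph (listProd m).graph⟩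
      (box_congr (Iso.refl A) ih)

theorem HasEdge.congr {G H : FGraph} (h : G.Iso H) : H.HasEdge → G.HasEdge := by
  obtain ⟨e⟩ := h
  rintro ⟨u, v, huv⟩
  exact ⟨e.symm u, e.symm v, e.symm.map_rel_iff.2 huv⟩

theorem prime_toSGraph {G : FGraph} (hG : G.Prime) : G.toSGraph.SPrime :=
  fun ⟨A, B, hA, hB, h⟩ => hG ⟨A.forget, B.forget, hA, hB, h.forget⟩

theorem exists_prime_listProd (G : FGraph) (hc : G.graph.Connected) :
    ∃ l : List FGraph, (∀ H ∈ l, H.Prime ∧ H.HasEdge) ∧ G.Iso (listProd l) := by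
  have hpos : ∀ (S : SGraph) (A B : FGraph), (∀ u v, S.sign u v = false) →
      S.forget.Iso (A.box B) → S.SwitchIso (A.toSGraph.box B.toSGraph) := by
    rintro S A B hS ⟨e⟩
    refine SGraph.SwitchIso.trans (H := (A.box B).toSGraph) ⟨e, fun _ => false, fun u v _ => ?_⟩ (toSGraph_box A B)
    rw [hS]
    rfl
  obtain ⟨l, hl, hGl⟩ := SGraph.exists_prime_listProd
    (p := fun S => ∀ u v, S.sign u v = false) (fun S hS hprime => by
      obtain ⟨A, B, hA, hB, h⟩ := not_not.1 hprime
      exact ⟨A.forget.toSGraph, B.forget.toSGraph, hA, hB, fun _ _ => rfl, fun _ _ => rfl,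
        hpos S _ _ hS h.forget⟩) _ G.toSGraph rfl (fun _ _ => rfl) hc
  refine ⟨l.map SGraph.forget, fun F hF => ?_, ?_⟩
  · obtain ⟨H, hH, rfl⟩ := List.mem_map.1 hF
    obtain ⟨hsign, hprime, hedge⟩ := hl H hH
    refine ⟨fun ⟨A, B, hA, hB, h⟩ => ?_, hedge⟩
    exact hprime ⟨A.toSGraph, B.toSGraph, hA, hB, hpos H A B hsign h⟩
  · rw [← SGraph.forget_listProd]
    exact hGl.forget

theorem rel_iso_of_listProd {l m : List FGraph} (hl : ∀ H ∈ l, H.Prime ∧ H.HasEdge)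
    (hm : ∀ H ∈ m, H.Prime ∧ H.HasEdge) (hc : (listProd l).graph.Connected)
    (h : (listProd l).Iso (listProd m)) :
    Multiset.Rel Iso (l : Multiset FGraph) (m : Multiset FGraph) := by
  have key : ∀ k : List FGraph, (∀ H ∈ k, H.Prime ∧ H.HasEdge) →
      ∀ S ∈ k.map toSGraph, S.SPrime ∧ S.HasEdge := by
    intro k hk S hS
    obtain ⟨H, hH, rfl⟩ := List.mem_map.1 hS
    exact ⟨prime_toSGraph (hk H hH).1, (hk H hH).2⟩
  have hrel := SGraph.rel_switchIso_of_listProd _ _ (key l hl) (key m hm)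
    ((toSGraph_listProd l).connected hc)
    (((toSGraph_listProd l).symm.trans h.toSGraph).trans (toSGraph_listProd m))
  rw [← Multiset.map_coe, ← Multiset.map_coe, Multiset.rel_map] at hrel
  exact hrel.mono fun _ _ _ _ h => h.forget

theorem exists_list_of_rel {E : Multiset FGraph} {l : List FGraph}
    (h : Multiset.Rel Iso E l) :
    ∃ m : List FGraph, (m : Multiset FGraph) = E ∧ (listProd m).Iso (listProd l) := by
  induction l generalizing E with
  | nil => exact ⟨[], (Multiset.rel_zero_right.1 h).symm, Iso.refl _⟩
  | cons A l ih =>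
    rw [← Multiset.cons_coe, Multiset.rel_cons_right] at h
    obtain ⟨B, E', hBA, hE', rfl⟩ := h
    obtain ⟨m, rfl, hm⟩ := ih hE'
    exact ⟨B :: m, rfl, box_congr hBA hm⟩

theorem IsDecomp.congr {G : FGraph} {D E : Multiset FGraph} (hD : G.IsDecomp D)
    (h : Multiset.Rel Iso E D) : G.IsDecomp E := by
  obtain ⟨hedge, l, rfl, hl⟩ := hD
  obtain ⟨m, rfl, hm⟩ := exists_list_of_rel h
  refine ⟨fun H hH => ?_, m, rfl, hl.trans hm.symm⟩
  obtain ⟨K, hK, hHK⟩ := Multiset.exists_mem_of_rel_of_mem h hH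
  exact (hedge K hK).congr hHK

theorem finer_of_rel_bind {K : Multiset FGraph} (f : FGraph → Multiset FGraph)
    (hf : ∀ H ∈ K, H.IsDecomp (f H)) :
    ∀ {M : Multiset FGraph}, Multiset.Rel Iso M (K.bind f) → Finer M K := by
  induction K using Multiset.induction with
  | empty =>
    intro M h
    rw [Multiset.zero_bind, Multiset.rel_zero_right] at h
    exact ⟨0, by simp [h]⟩
  | cons A K ih =>
    intro M h
    rw [Multiset.cons_bind, Multiset.rel_add_right] at h
    obtain ⟨M₁, M₂, h₁, h₂, rfl⟩ := h
    obtain ⟨p, hfst, hsnd, hp⟩ := ih (fun H hH => hf H (Multiset.mem_cons_of_mem hH)) h₂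
    refine ⟨(A, M₁) ::ₘ p, by simp [hfst], by simp [hsnd], fun x hx => ?_⟩
    rcases Multiset.mem_cons.1 hx with rfl | hx
    · exact (hf A (Multiset.mem_cons_self A K)).congr h₁
    · exact hp x hx

theorem listProd_flatMap (f : FGraph → List FGraph) {l : List FGraph}
    (hf : ∀ H ∈ l, H.Iso (listProd (f H))) : (listProd l).Iso (listProd (l.flatMap f)) := by
  induction l with
  | nil => exact Iso.refl _
  | cons A l ih =>
    rw [List.forall_mem_cons] at hf
    rw [List.flatMap_cons]
    exact (box_congr hf.1 (ih hf.2)).trans (listProd_append _ _)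

end FGraph

/-- Prime Decomposition Theorem for signed graphs: every connected signed
graph admits a prime s-decomposition, this decomposition is unique up to the
order of the factors and switching isomorphism of the factors, and the prime
factor decomposition of the underlying graph is finer than it. -/
theorem prime_sDecomp_exists_unique_finer (G : SGraph) (hG : G.graph.Connected) :
    (∃ D : Multiset SGraph, G.IsPrimeSDecomp D) ∧
    (∀ D₁ D₂ : Multiset SGraph, G.IsPrimeSDecomp D₁ → G.IsPrimeSDecomp D₂ →
      Multiset.Rel SGraph.SwitchIso D₁ D₂) ∧
    (∀ (Ds : Multiset SGraph) (D : Multiset FGraph),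
      G.IsPrimeSDecomp Ds → FGraph.IsPrimeDecomp G.forget D →
      FGraph.Finer D (Ds.map SGraph.forget)) := by
  refine ⟨?_, ?_, ?_⟩
  · obtain ⟨l, hl, hGl⟩ := SGraph.exists_prime_listProd (p := fun _ => True)
      (fun G _ h => by
        obtain ⟨A, B, hA, hB, h⟩ := not_not.1 h
        exact ⟨A, B, hA, hB, trivial, trivial, h⟩) _ G rfl trivial hG
    exact ⟨l, ⟨fun H hH => (hl H hH).2.2, l, rfl, hGl⟩, fun H hH => (hl H hH).2.1⟩
  · rintro _ _ ⟨⟨hedge₁, l, rfl, hl⟩, hprime₁⟩ ⟨⟨hedge₂, m, rfl, hm⟩, hprime₂⟩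
    exact SGraph.rel_switchIso_of_listProd l m (fun H hH => ⟨hprime₁ H hH, hedge₁ H hH⟩)
      (fun H hH => ⟨hprime₂ H hH, hedge₂ H hH⟩) (hl.connected hG) (hl.symm.trans hm)
  · rintro _ _ ⟨⟨_, l, rfl, hl⟩, _⟩ ⟨⟨hedge, m, rfl, hm⟩, hprime⟩
    have hdec : ∀ H ∈ l.map SGraph.forget, ∃ k : List FGraph,
        (∀ K ∈ k, K.Prime ∧ K.HasEdge) ∧ H.Iso (FGraph.listProd k) := by
      intro F hF
      obtain ⟨H, hH, rfl⟩ := List.mem_map.1 hF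
      exact FGraph.exists_prime_listProd _
        (SGraph.connected_of_mem_listProd (hl.connected hG) H hH)
    choose! f hf using hdec
    rw [Multiset.map_coe]
    refine FGraph.finer_of_rel_bind (fun F => (f F : Multiset FGraph))
      (fun F hF => ⟨fun K hK => ((hf F hF).1 K hK).2, f F, rfl, (hf F hF).2⟩) ?_
    rw [Multiset.coe_bind]
    refine FGraph.rel_iso_of_listProd (fun H hH => ⟨hprime H hH, hedge H hH⟩) ?_ ?_ ?_
    · intro K hK
      obtain ⟨F, hF, hKF⟩ := List.mem_flatMap.1 hK
      exact (hf F hF).1 K hKF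
    · obtain ⟨e⟩ := hm
      exact e.connected_iff.1 hG
    · refine hm.symm.trans (hl.forget.trans ?_)
      rw [SGraph.forget_listProd]
      exact FGraph.listProd_flatMap f fun F hF => (hf F hF).2
end

section
/- Let (G,σ) be a signed graph and S ⊆ V(G). Then S is s-redundant in (G,σ) if and only if for every z ∈ S and every pair of nonadjacent vertices x, y ∈ N(z) ∖ S, there exists a vertex w ∈ V(G) ∖ S adjacent to both x and y such that the 4-cycle x, w, y, z is balanced, i.e., σ(xw)·σ(wy)·σ(yz)·σ(zx) = +1. -/
open SimpleGraph

/-- `S` is s-redundant in `(G, σ)`: for every pair of distinct nonadjacent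
vertices `x, y ∉ S`, every `z ∈ S` and every signature `σ'` equivalent to `σ`,
if `x, z, y` is an unbalanced path then there is `w ∉ S` such that `x, w, y`
is an unbalanced path. -/
def SRedundant {V : Type*} (G : SimpleGraph V) (σ : V → V → Bool) (S : Set V) : Prop :=
  ∀ x y : V, x ∉ S → y ∉ S → x ≠ y → ¬ G.Adj x y →
    ∀ z ∈ S, ∀ σ' : V → V → Bool, SigEquiv G σ σ' →
      G.Adj x z → G.Adj z y → xor (σ' x z) (σ' z y) = true →
      ∃ w, w ∉ S ∧ G.Adj x w ∧ G.Adj w y ∧ xor (σ' x w) (σ' w y) = true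

/-- `S` is s-redundant in `(G, σ)` iff for every `z ∈ S` and every pair of
distinct nonadjacent neighbors `x, y ∈ N(z) \\ S` there is `w ∉ S` completing
a balanced `4`-cycle `x, w, y, z`. -/
theorem sRedundant_iff_balanced_C4
    {V : Type} [Fintype V] [DecidableEq V]
    (G : SimpleGraph V) (σ : V → V → Bool) (hσ : ∀ u v, σ u v = σ v u)
    (S : Set V) :
    SRedundant G σ S ↔
      ∀ z ∈ S, ∀ x y : V, G.Adj z x → G.Adj z y → x ∉ S → y ∉ S → x ≠ y →
        ¬ G.Adj x y →
        ∃ w, w ∉ S ∧ G.Adj x w ∧ G.Adj w y ∧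
          xor (σ x w) (xor (σ w y) (xor (σ y z) (σ z x))) = false := by
  constructor
  · intro h z hz x y hzx hzy hx hy hxy hnadj
    -- switch at `x` if necessary, so that the path `x, z, y` becomes unbalanced
    let s : V → Bool := fun v => if v = x then !(xor (σ x z) (σ z y)) else false
    have hsx : s x = !(xor (σ x z) (σ z y)) := if_pos rfl
    have hs {v : V} (hv : v ≠ x) : s v = false := if_neg hv
    obtain ⟨w, hw, hxw, hwy, hunbal⟩ := h x y hx hy hxy hnadj z hz
      (fun u v => xor (σ u v) (xor (s u) (s v))) ⟨s, fun _ _ _ => rfl⟩ hzx.symm hzy (by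
        simp only [hsx, hs hzx.ne, hs hxy.symm]
        cases σ x z <;> cases σ z y <;> rfl)
    refine ⟨w, hw, hxw, hwy, ?_⟩
    simp only [hsx, hs hxw.ne', hs hxy.symm] at hunbal
    rw [hσ y z, hσ z x]
    revert hunbal
    cases σ x z <;> cases σ z y <;> cases σ x w <;> cases σ w y <;> decide
  · rintro h x y hx hy hxy hnadj z hz σ' ⟨s, hs⟩ hxz hzy hunbal
    obtain ⟨w, hw, hxw, hwy, hbal⟩ := h z hz x y hxz.symm hzy hx hy hxy hnadj
    refine ⟨w, hw, hxw, hwy, ?_⟩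
    rw [hs x z hxz, hs z y hzy] at hunbal
    rw [hs x w hxw, hs w y hwy]
    rw [hσ y z, hσ z x] at hbal
    revert hunbal hbal
    cases σ x z <;> cases σ z y <;> cases σ x w <;> cases σ w y <;>
      cases s x <;> cases s y <;> cases s z <;> cases s w <;> decide
end

section
/- If (G,σ) is a signed graph and S is an s-redundant set of (G,σ), then χ_s(G,σ) ≤ |S| + χ_s((G,σ) − S), where (G,σ) − S denotes the signed subgraph of (G,σ) induced on V(G) ∖ S. -/
open SimpleGraph

/-- A map to `Fin n` that separates adjacent vertices and identifies only edges of equal sign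
(after switching) is a homomorphism onto its image signed graph. -/
lemma exists_sHom_of_consistent {V : Type*} (G : SimpleGraph V) (σ σ' : V → V → Bool)
    (h : SigEquiv G σ σ') {n : ℕ} (f : V → Fin n) (hf : ∀ u v, G.Adj u v → f u ≠ f v)
    (hc : ∀ u v u' v', G.Adj u v → G.Adj u' v' → f u = f u' → f v = f v' →
      σ' u v = σ' u' v') :
    ∃ (H : SimpleGraph (Fin n)) (π : Fin n → Fin n → Bool), SHom G σ H π := by
  classical
  refine ⟨⊤, fun a b => decide (∃ u v, G.Adj u v ∧ f u = a ∧ f v = b ∧ σ' u v = true),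
    ⟨f, fun {u v} huv => hf u v huv⟩, σ', h, fun u v huv => ?_⟩
  rw [Bool.eq_iff_iff, decide_eq_true_iff]
  constructor
  · rintro ⟨u', v', huv', hu, hv, ht⟩
    exact (hc u v u' v' huv huv' hu.symm hv.symm).trans ht
  · exact fun ht => ⟨u, v, huv, rfl, rfl, ht⟩

/-- The bound on the chromatic number given by a consistent map to a finite type. -/
lemma sChrom_le_card_of_consistent {V T : Type*} [Fintype T] (G : SimpleGraph V)
    (σ σ' : V → V → Bool) (h : SigEquiv G σ σ') (f : V → T)
    (hf : ∀ u v, G.Adj u v → f u ≠ f v)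
    (hc : ∀ u v u' v', G.Adj u v → G.Adj u' v' → f u = f u' → f v = f v' →
      σ' u v = σ' u' v') :
    sChrom G σ ≤ Fintype.card T :=
  Nat.sInf_le <| exists_sHom_of_consistent G σ σ' h (Fintype.equivFin T ∘ f)
    (fun u v huv heq => hf u v huv ((Fintype.equivFin T).injective heq))
    fun u v u' v' huv huv' hu hv => hc u v u' v' huv huv'
      ((Fintype.equivFin T).injective hu) ((Fintype.equivFin T).injective hv)

/-- On a finite signed graph the chromatic number is attained. -/
lemma exists_sHom_sChrom {V : Type*} [Fintype V] (G : SimpleGraph V) (σ : V → V → Bool) :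
    ∃ (H : SimpleGraph (Fin (sChrom G σ))) (π : Fin (sChrom G σ) → Fin (sChrom G σ) → Bool),
      SHom G σ H π := by
  refine Nat.sInf_mem (s := {n : ℕ | ∃ (H : SimpleGraph (Fin n)) (π : Fin n → Fin n → Bool),
    SHom G σ H π}) ⟨Fintype.card V, ?_⟩
  refine exists_sHom_of_consistent G σ σ ⟨fun _ => false, by simp⟩ (Fintype.equivFin V)
    (fun u v huv heq => huv.ne ((Fintype.equivFin V).injective heq)) ?_
  intro u v u' v' _ _ hu hv
  rw [(Fintype.equivFin V).injective hu, (Fintype.equivFin V).injective hv]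

/-- Removing an s-redundant set `S` decreases the chromatic number of a signed
graph by at most `|S|`. -/
theorem chrom_le_card_add_chrom_of_sRedundant
    {V : Type} [Fintype V] [DecidableEq V]
    (G : SimpleGraph V) (σ : V → V → Bool) (hσ : ∀ u v, σ u v = σ v u)
    (S : Finset V) (hS : SRedundant G σ (↑S : Set V)) :
    sChrom G σ ≤ S.card +
      sChrom (G.induce {v : V | v ∉ S}) (fun a b => σ a.1 b.1) := by
  obtain ⟨H, π, φ, τ, ⟨s, hs⟩, hπ⟩ :=
    exists_sHom_sChrom (G.induce {v : V | v ∉ S}) (fun a b => σ a.1 b.1)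
  let s' : V → Bool := fun v => if h : v ∉ S then s ⟨v, h⟩ else false
  let σ' : V → V → Bool := fun u v => xor (σ u v) (xor (s' u) (s' v))
  have hσ' : SigEquiv G σ σ' := ⟨s', fun _ _ _ => rfl⟩
  have hsymm : ∀ u v, σ' u v = σ' v u := fun u v => by
    simp only [σ', hσ u v, Bool.xor_comm (s' u)]
  have hφ : ∀ (u v : V) (hu : u ∉ S) (hv : v ∉ S), G.Adj u v →
      π (φ ⟨u, hu⟩) (φ ⟨v, hv⟩) = σ' u v := by
    intro u v hu hv huv
    have hadj : (G.induce {v : V | v ∉ S}).Adj ⟨u, hu⟩ ⟨v, hv⟩ := huv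
    rw [hπ _ _ hadj, hs _ _ hadj]
    simp [σ', s', hu, hv]
  have hne : ∀ (u v : V) (hu : u ∉ S) (hv : v ∉ S), G.Adj u v →
      φ ⟨u, hu⟩ ≠ φ ⟨v, hv⟩ := by
    intro u v hu hv huv
    have hadj : (G.induce {v : V | v ∉ S}).Adj ⟨u, hu⟩ ⟨v, hv⟩ := huv
    exact (φ.map_adj hadj).ne
  have hkey : ∀ (z x y : V) (hx : x ∉ S) (hy : y ∉ S), z ∈ S → G.Adj x z → G.Adj y z →
      φ ⟨x, hx⟩ = φ ⟨y, hy⟩ → σ' x z = σ' y z := by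
    intro z x y hx hy hz hxz hyz hxy
    by_contra hcon
    have hsign : xor (σ' x z) (σ' z y) = true := by
      rw [hsymm z y]
      simpa using hcon
    obtain ⟨w, hw, hxw, hwy, hunb⟩ := hS x y (by simpa using hx) (by simpa using hy)
      (fun h => hcon (by rw [h])) (fun h => hne x y hx hy h hxy) z (by simpa using hz) σ' hσ'
      hxz hyz.symm hsign
    have hw' : w ∉ S := by simpa using hw
    rw [hsymm w y, ← hφ x w hx hw' hxw, ← hφ y w hy hw' hwy.symm, hxy] at hunb
    simp at hunb
  let f : V → S ⊕ Fin (sChrom (G.induce {v : V | v ∉ S}) (fun a b => σ a.1 b.1)) :=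
    fun v => if h : v ∈ S then Sum.inl ⟨v, h⟩ else Sum.inr (φ ⟨v, h⟩)
  have hcard := sChrom_le_card_of_consistent G σ σ' hσ' f ?_ ?_
  · simpa using hcard
  · intro u v huv
    by_cases hu : u ∈ S <;> by_cases hv : v ∈ S
    · simpa [f, hu, hv] using huv.ne
    · simp [f, hu, hv]
    · simp [f, hu, hv]
    · simpa [f, hu, hv] using hne u v hu hv huv
  · intro u v u' v' huv huv' hfu hfv
    by_cases hu : u ∈ S <;> by_cases hu' : u' ∈ S <;> simp [f, hu, hu'] at hfu <;>
      by_cases hv : v ∈ S <;> by_cases hv' : v' ∈ S <;> simp [f, hv, hv'] at hfv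
    · rw [hfu, hfv]
    · subst hfu
      rw [hsymm u v, hsymm u v']
      exact hkey u v v' hv hv' hu huv.symm huv'.symm hfv
    · subst hfv
      exact hkey v u u' hu hu' hv huv huv' hfu
    · rw [← hφ u v hu hv huv, ← hφ u' v' hu' hv' huv', hfu, hfv]
end

section
/- For all integers p, q ≥ 2, χ_s(K_p⁺ □ K_q⁻) = ⌈pq/2⌉, where K_p⁺ is the complete signed graph on p vertices with all edges positive and K_q⁻ is the complete signed graph on q vertices with all edges negative. -/
open SimpleGraph

/-- A colouring of the `p × q` grid with `n` colours, together with a switching `s`: distinct cells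
of the same colour share no line and are switched differently, and no two colour classes with two
cells each are joined by both a row edge and a column edge forming a matching. -/
def GridColoring (p q n : ℕ) : Prop :=
  ∃ (c : ℕ → ℕ → ℕ) (s : ℕ → ℕ → Bool),
    (∀ i a, i < p → a < q → c i a < n) ∧
    (∀ i j a b, i < p → j < p → a < q → b < q → c i a = c j b →
      (i = j ∧ a = b) ∨ (i ≠ j ∧ a ≠ b ∧ s i a ≠ s j b)) ∧
    (∀ i j k a b e, i < p → j < p → k < p → a < q → b < q → e < q →
      i ≠ j → i ≠ k → j ≠ k → a ≠ b → a ≠ e → b ≠ e → c i a = c j e → c i b ≠ c k e)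

theorem GridColoring.transpose {p q n : ℕ} (h : GridColoring p q n) : GridColoring q p n := by
  obtain ⟨c, s, h₁, h₂, h₃⟩ := h
  refine ⟨fun i a => c a i, fun i a => s a i, fun i a hi ha => h₁ a i ha hi, ?_, ?_⟩
  · intro i j a b hi hj ha hb hc
    have := h₂ a b i j ha hb hi hj hc
    tauto
  · intro i j k a b e hi hj hk ha hb he hij hik hjk hab hae hbe hc hc'
    exact h₃ e a b j k i he ha hb hj hk hi hae.symm hbe.symm hab hjk hij.symm hik.symm
      hc.symm hc'.symm

theorem gridColoring_zero_left (q : ℕ) : GridColoring 0 q 0 :=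
  ⟨fun _ _ => 0, fun _ _ => false, by simp, by simp, by simp⟩

/-- Two further rows can be coloured with `q` new colours along a cyclic shift. -/
theorem GridColoring.add_two {p q n : ℕ} (hq : 2 ≤ q) (h : GridColoring p q n) :
    GridColoring (p + 2) q (n + q) := by
  obtain ⟨c, s, h₁, h₂, h₃⟩ := h
  refine ⟨fun i a => if i < p then c i a else if i = p then n + a else
      if a = 0 then n + (q - 1) else n + (a - 1),
    fun i a => if i < p then s i a else decide (i = p), ?_, ?_, ?_⟩
  · intro i a hi ha
    have := h₁ i a
    grind
  · intro i j a b hi hj ha hb hc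
    have := h₁ i a
    have := h₁ j b
    have := h₂ i j a b
    grind
  · intro i j k a b e hi hj hk ha hb he hij hik hjk hab hae hbe hc hc'
    have := h₁ i a
    have := h₁ j e
    have := h₁ i b
    have := h₁ k e
    have := h₃ i j k a b e
    grind

theorem GridColoring.add_two_mul {p q n : ℕ} (hq : 2 ≤ q) (h : GridColoring p q n) (m : ℕ) :
    GridColoring (p + 2 * m) q (n + m * q) := by
  induction m with
  | zero => simpa using h
  | succ m ih =>
    have := ih.add_two hq
    rwa [show p + 2 * (m + 1) = p + 2 * m + 2 by ring,
      show n + (m + 1) * q = n + m * q + q by ring]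

theorem gridColoring_three_three : GridColoring 3 3 5 := by
  have key : ∃ (c : Fin 3 → Fin 3 → ℕ) (s : Fin 3 → Fin 3 → Bool),
      (∀ i a, c i a < 5) ∧
      (∀ i j a b, c i a = c j b → (i = j ∧ a = b) ∨ (i ≠ j ∧ a ≠ b ∧ s i a ≠ s j b)) ∧
      (∀ i j k, i ≠ j → i ≠ k → j ≠ k → ∀ a b e, a ≠ b → a ≠ e → b ≠ e →
        c i a = c j e → c i b ≠ c k e) := by
    refine ⟨![![0, 1, 2], ![3, 4, 1], ![4, 2, 3]],
      ![![false, false, false], ![false, false, true], ![true, true, true]], ?_, ?_, ?_⟩ <;>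
    decide
  obtain ⟨c, s, h₁, h₂, h₃⟩ := key
  refine ⟨fun i a => c (Fin.ofNat 3 i) (Fin.ofNat 3 a), fun i a => s (Fin.ofNat 3 i) (Fin.ofNat 3 a),
    fun i a _ _ => h₁ _ _, ?_, ?_⟩
  · intro i j a b hi hj ha hb hc
    have := h₂ _ _ _ _ hc
    simpa [Fin.ext_iff, Nat.mod_eq_of_lt, hi, hj, ha, hb] using this
  · intro i j k a b e hi hj hk ha hb he hij hik hjk hab hae hbe
    apply h₃ <;> simpa [Fin.ext_iff, Nat.mod_eq_of_lt, hi, hj, hk, ha, hb, he]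

theorem gridColoring_half {p q : ℕ} (hp : 2 ≤ p) (hq : 2 ≤ q) :
    GridColoring p q ((p * q + 1) / 2) := by
  obtain ⟨k, rfl | rfl⟩ := Nat.even_or_odd' p
  · have := (gridColoring_zero_left q).add_two_mul hq k
    rw [show (2 * k * q + 1) / 2 = 0 + k * q by rw [mul_assoc]; omega]
    simpa using this
  obtain ⟨l, rfl | rfl⟩ := Nat.even_or_odd' q
  · have := (gridColoring_zero_left (2 * k + 1)).add_two_mul hp l
    rw [show ((2 * k + 1) * (2 * l) + 1) / 2 = 0 + l * (2 * k + 1) by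
      rw [show (2 * k + 1) * (2 * l) = 2 * (l * (2 * k + 1)) by ring]; omega]
    simpa using this.transpose
  · obtain ⟨k, rfl⟩ : ∃ m, k = m + 1 := ⟨k - 1, by omega⟩
    obtain ⟨l, rfl⟩ : ∃ m, l = m + 1 := ⟨l - 1, by omega⟩
    have := ((gridColoring_three_three.add_two_mul (by norm_num) k).transpose).add_two_mul
      (by omega) l
    convert this.transpose using 1
    · ring
    · ring
    · rw [show (2 * (k + 1) + 1) * (2 * (l + 1) + 1) + 1 = 2 * (5 + k * 3 + l * (3 + 2 * k)) by ring]
      omega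

theorem GridColoring.exists_sHom {p q n : ℕ} (h : GridColoring p q n) :
    ∃ (H : SimpleGraph (Fin n)) (π : Fin n → Fin n → Bool),
      SHom ((⊤ : SimpleGraph (Fin p)) □ (⊤ : SimpleGraph (Fin q)))
        (prodSign (fun _ _ => false) (fun _ _ => true)) H π := by
  classical
  obtain ⟨c, s, h₁, h₂, h₃⟩ := h
  let G := (⊤ : SimpleGraph (Fin p)) □ (⊤ : SimpleGraph (Fin q))
  let f : Fin p × Fin q → Fin n := fun x => ⟨c x.1 x.2, h₁ _ _ x.1.2 x.2.2⟩
  let τ : Fin p × Fin q → Fin p × Fin q → Bool := fun x y =>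
    xor (prodSign (fun _ _ => false) (fun _ _ => true) x y) (xor (s x.1 x.2) (s y.1 y.2))
  have hf : ∀ x y, G.Adj x y → f x ≠ f y := by
    rintro ⟨i, a⟩ ⟨j, b⟩ hadj he
    have := h₂ i j a b i.2 j.2 a.2 b.2 (congrArg Fin.val he)
    simp only [G, boxProd_adj, top_adj, ne_eq, Fin.ext_iff] at hadj
    tauto
  have hτ : ∀ x y x' y', G.Adj x y → G.Adj x' y' → f x = f x' → f y = f y' →
      τ x y = τ x' y' := by
    rintro ⟨i, a⟩ ⟨j, b⟩ ⟨k, d⟩ ⟨l, e⟩ hxy hxy' hx hy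
    have hx' : c i a = c k d := congrArg Fin.val hx
    have hy' : c j b = c l e := congrArg Fin.val hy
    have e₁ : ((i : ℕ) = k ∧ (a : ℕ) = d ∧ s i a = s k d) ∨
        ((i : ℕ) ≠ k ∧ (a : ℕ) ≠ d ∧ s i a ≠ s k d) := by
      have := h₂ i k a d i.2 k.2 a.2 d.2 hx'
      grind
    have e₂ : ((j : ℕ) = l ∧ (b : ℕ) = e ∧ s j b = s l e) ∨
        ((j : ℕ) ≠ l ∧ (b : ℕ) ≠ e ∧ s j b ≠ s l e) := by
      have := h₂ j l b e j.2 l.2 b.2 e.2 hy'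
      grind
    have e₃ := h₃ i k l a b d i.2 k.2 l.2 a.2 b.2 d.2
    have e₄ := h₃ k i j d e a k.2 i.2 j.2 d.2 e.2 a.2
    simp only [G, boxProd_adj, top_adj, ne_eq, Fin.ext_iff] at hxy hxy'
    simp only [τ, prodSign, Fin.ext_iff]
    clear hx hy h₂ h₃ hf
    generalize s i a = u, s j b = v, s k d = u', s l e = v' at *
    split_ifs <;> cases u <;> cases v <;> cases u' <;> cases v' <;> grind
  refine ⟨⟨fun u v => ∃ x y, G.Adj x y ∧ f x = u ∧ f y = v, ⟨?_⟩, ⟨?_⟩⟩,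
    fun u v => decide (∃ x y, G.Adj x y ∧ f x = u ∧ f y = v ∧ τ x y = true),
    ⟨f, fun {x y} hxy => ⟨x, y, hxy, rfl, rfl⟩⟩, τ, ⟨fun x => s x.1 x.2, fun _ _ _ => rfl⟩, ?_⟩
  · rintro u v ⟨x, y, hxy, hx, hy⟩
    exact ⟨y, x, hxy.symm, hy, hx⟩
  · rintro u ⟨x, y, hxy, hx, hy⟩
    exact hf x y hxy (hx.trans hy.symm)
  · intro x y hxy
    rw [Bool.eq_iff_iff, decide_eq_true_iff]
    constructor
    · rintro ⟨x', y', hxy', hx, hy, ht⟩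
      rw [← ht]
      exact hτ x y x' y' hxy hxy' hx.symm hy.symm
    · exact fun ht => ⟨x, y, hxy, rfl, rfl, ht⟩

/-- Distinct vertices with a common image under a homomorphism are switched differently, so a
target of a homomorphism has at least `pq / 2` vertices. -/
theorem mul_le_of_sHom {p q n : ℕ} {H : SimpleGraph (Fin n)} {π : Fin n → Fin n → Bool}
    (h : SHom ((⊤ : SimpleGraph (Fin p)) □ (⊤ : SimpleGraph (Fin q)))
      (prodSign (fun _ _ => false) (fun _ _ => true)) H π) :
    p * q ≤ n * 2 := by
  obtain ⟨φ, σ', ⟨t, ht⟩, hπ⟩ := h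
  have hinj : Function.Injective fun x => (φ x, t x) := by
    rintro ⟨i, a⟩ ⟨j, b⟩ hxy
    obtain ⟨hφ, hs⟩ := Prod.mk.inj hxy
    by_contra hne
    by_cases hij : i = j
    · subst hij
      have hab : a ≠ b := fun e => hne (by rw [e])
      exact (φ.map_adj (by simpa [boxProd_adj] using hab :
        ((⊤ : SimpleGraph (Fin p)) □ (⊤ : SimpleGraph (Fin q))).Adj (i, a) (i, b))).ne hφ
    by_cases hab : a = b
    · subst hab
      exact (φ.map_adj (by simpa [boxProd_adj] using hij :
        ((⊤ : SimpleGraph (Fin p)) □ (⊤ : SimpleGraph (Fin q))).Adj (i, a) (j, a))).ne hφ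
    have adj₁ : ((⊤ : SimpleGraph (Fin p)) □ (⊤ : SimpleGraph (Fin q))).Adj (i, a) (i, b) := by
      simpa [boxProd_adj] using hab
    have adj₂ : ((⊤ : SimpleGraph (Fin p)) □ (⊤ : SimpleGraph (Fin q))).Adj (j, b) (i, b) := by
      simpa [boxProd_adj] using fun e => hij e.symm
    have e₁ := hπ _ _ adj₁
    have e₂ := hπ _ _ adj₂
    rw [ht _ _ adj₁] at e₁
    rw [ht _ _ adj₂, ← hφ, e₁, hs] at e₂
    simp [prodSign, Ne.symm hij] at e₂
  simpa using Fintype.card_le_of_injective _ hinj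

/-- The chromatic number of `K_p⁺ □ K_q⁻` is `⌈pq / 2⌉`. -/
theorem chrom_completePos_box_completeNeg (p q : ℕ) (hp : 2 ≤ p) (hq : 2 ≤ q) :
    sChrom ((⊤ : SimpleGraph (Fin p)) □ (⊤ : SimpleGraph (Fin q)))
      (prodSign (fun _ _ => false) (fun _ _ => true)) = (p * q + 1) / 2 := by
  refine le_antisymm (Nat.sInf_le (gridColoring_half hp hq).exists_sHom) ?_
  refine le_csInf ⟨_, (gridColoring_half hp hq).exists_sHom⟩ ?_
  rintro n ⟨H, π, h⟩
  have := mul_le_of_sHom h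
  omega
end
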